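/- arXiv:0707.3046 — 4 statements merged into one kernel-verified Lean document; each statement's English description precedes it below -/
import Mathlib

section
/- Let λ be a partition of n, let i ∈ {0,1}, let 𝐢 = (i₁,…,i_k) ∈ {0,1}^k be an alternating bit string, let j = (j₁,…,j_k) ∈ ℤ_{≥0}^k with j₁+⋯+j_k = n, and let d = 𝐢^j ∈ {0,1}ⁿ. Then the number of standard tableaux of shape λ with i-parity equal to d is j₁!⋯j_k! times the number of chess tableaux of shape λ, parity i*, and content j, where i* ∈ {0,1} is the parity of i + i₁ + 1. In symbols: |Tab^{(i)}(λ; d)| = j₁!⋯j_k! · |Chess^{(i*)}_j(λ)|. -/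
/-! Statement 1: |Tab^{(i)}(λ; d)| = j₁!⋯j_k! · |Chess^{(i*)}_j(λ)| where d = 𝐢^j
and i* is the parity of i + i₁ + 1. -/

def IsPartition (l : ℕ → ℕ) : Prop :=
  (∀ m n : ℕ, m ≤ n → l n ≤ l m) ∧ ∃ N, ∀ n, N ≤ n → l n = 0

def boxes (l : ℕ → ℕ) : Set (ℕ × ℕ) := {b | b.2 < l b.1}

noncomputable def psize (l : ℕ → ℕ) : ℕ := ∑ᶠ s, l s

def boxParity (i s t : ℕ) : ℕ := (s + t + i) % 2

/-- Standard tableau of shape `l` with `|λ| = n`: a bijective labelling of the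
boxes by `{1,…,n}`, strictly increasing along rows and down columns. -/
def IsStandardTableau (l : ℕ → ℕ) (n : ℕ) (T : ℕ × ℕ → ℕ) : Prop :=
  Set.BijOn T (boxes l) (Set.Icc 1 n) ∧
  (∀ s t t' : ℕ, t < t' → (s, t') ∈ boxes l → T (s, t) < T (s, t')) ∧
  (∀ s s' t : ℕ, s < s' → (s', t) ∈ boxes l → T (s, t) < T (s', t))

/-- The set `Tab^{(i)}(λ; d)`: standard tableaux of shape `l` whose `i`-parity
is the bit string `d` (tableaux are normalised to be `0` off the diagram). -/
def TabSet (l : ℕ → ℕ) (n i : ℕ) (d : ℕ → ℕ) : Set (ℕ × ℕ → ℕ) :=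
  {T | IsStandardTableau l n T ∧ (∀ b ∉ boxes l, T b = 0) ∧
    ∀ b ∈ boxes l, boxParity i b.1 b.2 = d (T b)}

def IsChessTableau (l : ℕ → ℕ) (i k : ℕ) (j : ℕ → ℕ) (T : ℕ × ℕ → ℕ) : Prop :=
  (∀ b ∈ boxes l, 1 ≤ T b ∧ T b ≤ k) ∧
  (∀ t, 1 ≤ t → t ≤ k → {b ∈ boxes l | T b = t}.ncard = j t) ∧
  (∀ s t t' : ℕ, t < t' → (s, t') ∈ boxes l → T (s, t) < T (s, t')) ∧
  (∀ s s' t : ℕ, s < s' → (s', t) ∈ boxes l → T (s, t) ≤ T (s', t)) ∧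
  (∀ b ∈ boxes l, T b % 2 = boxParity i b.1 b.2)

/-- The set `Chess^{(i)}_j(λ)` (normalised to be `0` off the diagram). -/
def ChessSet (l : ℕ → ℕ) (i k : ℕ) (j : ℕ → ℕ) : Set (ℕ × ℕ → ℕ) :=
  {T | IsChessTableau l i k j T ∧ ∀ b ∉ boxes l, T b = 0}

/-- `σ(t) = min { s | j₁ + ⋯ + j_s ≥ t }`. -/
noncomputable def sigmaOf (j : ℕ → ℕ) (t : ℕ) : ℕ :=
  sInf {s | t ≤ ∑ r ∈ Finset.Icc 1 s, j r}

/-- `(i₁,…,i_k)` is an alternating bit string. -/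
def Alternating (k : ℕ) (ii : ℕ → ℕ) : Prop :=
  (∀ t, 1 ≤ t → t ≤ k → ii t ≤ 1) ∧ ∀ t, 1 ≤ t → t < k → ii (t + 1) = 1 - ii t

theorem finite_boxes {l : ℕ → ℕ} (hl : IsPartition l) : (boxes l).Finite := by
  obtain ⟨hmono, N, hN⟩ := hl
  refine ((Set.finite_Iio N).prod (Set.finite_Iio (l 0))).subset ?_
  rintro ⟨s, t⟩ hb
  have hb : t < l s := hb
  refine ⟨?_, hb.trans_le (hmono 0 s (Nat.zero_le s))⟩
  by_contra hs
  simp [hN s (not_lt.mp hs)] at hb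

theorem mem_boxes_of_le {l : ℕ → ℕ} (hl : IsPartition l) {s s' t t' : ℕ} (hs : s ≤ s')
    (ht : t ≤ t') (hb : (s', t') ∈ boxes l) : (s, t) ∈ boxes l :=
  ht.trans_lt (lt_of_lt_of_le (show t' < l s' from hb) (hl.1 s s' hs))

theorem sigmaOf_zero (j : ℕ → ℕ) : sigmaOf j 0 = 0 :=
  Nat.sInf_eq_zero.mpr (Or.inl (Nat.zero_le _))

theorem sigmaOf_le_iff {j : ℕ → ℕ} {k t : ℕ} (ht : t ≤ ∑ r ∈ Finset.Icc 1 k, j r) (s : ℕ) :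
    sigmaOf j t ≤ s ↔ t ≤ ∑ r ∈ Finset.Icc 1 s, j r := by
  refine ⟨fun h => ?_, fun h => Nat.sInf_le h⟩
  have hmem : t ≤ ∑ r ∈ Finset.Icc 1 (sigmaOf j t), j r :=
    Nat.sInf_mem (s := {s | t ≤ ∑ r ∈ Finset.Icc 1 s, j r}) ⟨k, ht⟩
  exact hmem.trans (Finset.sum_le_sum_of_subset (Finset.Icc_subset_Icc_right h))

theorem sigmaOf_mono {j : ℕ → ℕ} {k x y : ℕ} (hxy : x ≤ y)
    (hy : y ≤ ∑ r ∈ Finset.Icc 1 k, j r) : sigmaOf j x ≤ sigmaOf j y :=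
  (sigmaOf_le_iff (hxy.trans hy) _).mpr (hxy.trans ((sigmaOf_le_iff hy _).mp le_rfl))

theorem sigmaOf_pos {j : ℕ → ℕ} {k x : ℕ} (hx : 1 ≤ x)
    (hxk : x ≤ ∑ r ∈ Finset.Icc 1 k, j r) : 1 ≤ sigmaOf j x := by
  by_contra h
  have := (sigmaOf_le_iff hxk 0).mp (by omega)
  simp at this
  omega

theorem ncard_sigmaOf_fiber {j : ℕ → ℕ} {k t : ℕ} (ht : 1 ≤ t) (htk : t ≤ k) :
    {x | x ∈ Set.Icc 1 (∑ r ∈ Finset.Icc 1 k, j r) ∧ sigmaOf j x = t}.ncard = j t := by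
  obtain ⟨u, rfl⟩ : ∃ u, t = u + 1 := ⟨t - 1, by omega⟩
  have hsucc : ∑ r ∈ Finset.Icc 1 (u + 1), j r = ∑ r ∈ Finset.Icc 1 u, j r + j (u + 1) :=
    Finset.sum_Icc_succ_top (by omega) _
  have hle : ∑ r ∈ Finset.Icc 1 (u + 1), j r ≤ ∑ r ∈ Finset.Icc 1 k, j r :=
    Finset.sum_le_sum_of_subset (Finset.Icc_subset_Icc_right htk)
  have hset : {x | x ∈ Set.Icc 1 (∑ r ∈ Finset.Icc 1 k, j r) ∧ sigmaOf j x = u + 1} =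
      (Finset.Ioc (∑ r ∈ Finset.Icc 1 u, j r) (∑ r ∈ Finset.Icc 1 (u + 1), j r) : Set ℕ) := by
    ext x
    simp only [Set.mem_ofPred_eq, Set.mem_Icc, Finset.coe_Ioc, Set.mem_Ioc]
    constructor
    · rintro ⟨⟨-, hxk⟩, hx⟩
      have h1 := sigmaOf_le_iff hxk u
      have h2 := sigmaOf_le_iff hxk (u + 1)
      omega
    · rintro ⟨hlo, hhi⟩
      have h1 := sigmaOf_le_iff (hhi.trans hle) u
      have h2 := sigmaOf_le_iff (hhi.trans hle) (u + 1)
      omega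
  rw [hset, Set.ncard_coe_finset, Nat.card_Ioc, hsucc]
  omega

theorem Alternating.apply_eq {k : ℕ} {ii : ℕ → ℕ} (h : Alternating k ii) {t : ℕ} (ht : 1 ≤ t)
    (htk : t ≤ k) : ii t = (ii 1 + t + 1) % 2 := by
  induction t, ht using Nat.le_induction with
  | base =>
    have := h.1 1 le_rfl htk
    omega
  | succ t ht ih =>
    have := ih (by omega)
    have := h.2 t ht (by omega)
    omega

/-- The parity condition on a standard tableau, read off from the block containing a label. -/
theorem boxParity_eq_iff {k n : ℕ} {ii j d : ℕ → ℕ} (hii : Alternating k ii)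
    (hjsum : ∑ t ∈ Finset.Icc 1 k, j t = n)
    (hd : ∀ t, 1 ≤ t → t ≤ n → d t = ii (sigmaOf j t)) (i s t : ℕ) {x : ℕ}
    (hx : x ∈ Set.Icc 1 n) :
    boxParity i s t = d x ↔ sigmaOf j x % 2 = boxParity ((i + ii 1 + 1) % 2) s t := by
  have hxk : x ≤ ∑ t ∈ Finset.Icc 1 k, j t := hjsum ▸ hx.2
  rw [hd x hx.1 hx.2, hii.apply_eq (sigmaOf_pos hx.1 hxk) ((sigmaOf_le_iff hxk k).mpr hxk)]
  unfold boxParity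
  omega

theorem sigmaOf_comp_mem_chessSet {l : ℕ → ℕ} (hl : IsPartition l) {n i k : ℕ}
    {ii j d : ℕ → ℕ} (hii : Alternating k ii) (hjsum : ∑ t ∈ Finset.Icc 1 k, j t = n)
    (hd : ∀ t, 1 ≤ t → t ≤ n → d t = ii (sigmaOf j t)) {T : ℕ × ℕ → ℕ}
    (hT : T ∈ TabSet l n i d) :
    sigmaOf j ∘ T ∈ ChessSet l ((i + ii 1 + 1) % 2) k j := by
  obtain ⟨⟨hbij, hrow, hcol⟩, hzero, hpar⟩ := hT
  have hpar' : ∀ b ∈ boxes l,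
      sigmaOf j (T b) % 2 = boxParity ((i + ii 1 + 1) % 2) b.1 b.2 := fun b hb =>
    (boxParity_eq_iff hii hjsum hd i b.1 b.2 (hbij.mapsTo hb)).mp (hpar b hb)
  have hmono : ∀ b ∈ boxes l, ∀ x, x ≤ T b → sigmaOf j x ≤ sigmaOf j (T b) := fun b hb x hx =>
    sigmaOf_mono hx (hjsum ▸ (hbij.mapsTo hb).2)
  refine ⟨⟨fun b hb => ?_, fun t ht htk => ?_, fun s t t' htt hb => ?_, fun s s' t hss hb => ?_,
    hpar'⟩, fun b hb => ?_⟩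
  · have hx := hbij.mapsTo hb
    rw [← hjsum] at hx
    exact ⟨sigmaOf_pos hx.1 hx.2, (sigmaOf_le_iff hx.2 k).mpr hx.2⟩
  · rw [← ncard_sigmaOf_fiber (j := j) ht htk, hjsum]
    refine Set.ncard_congr (fun b _ => T b) (fun b hb => ⟨hbij.mapsTo hb.1, hb.2⟩)
      (fun a b ha hb h => hbij.injOn ha.1 hb.1 h) ?_
    rintro x ⟨hx, hxt⟩
    obtain ⟨b, hb, rfl⟩ := hbij.surjOn hx
    exact ⟨b, ⟨hb, hxt⟩, rfl⟩
  · have hb1 : (s, t + 1) ∈ boxes l := mem_boxes_of_le hl le_rfl htt hb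
    have hb0 : (s, t) ∈ boxes l := mem_boxes_of_le hl le_rfl htt.le hb
    have h0 := hpar' _ hb0
    have h1 := hpar' _ hb1
    have hstep := hmono _ hb1 _ (hrow s t (t + 1) (by omega) hb1).le
    have hle : T (s, t + 1) ≤ T (s, t') := by
      rcases (show t + 1 ≤ t' from htt).eq_or_lt with h | h
      · rw [h]
      · exact (hrow s _ _ h hb).le
    have := hmono _ hb _ hle
    simp only [boxParity] at h0 h1
    simp only [Function.comp_apply]
    omega
  · exact hmono _ hb _ (hcol s s' t hss hb).le
  · simp [hzero b hb, sigmaOf_zero]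

/-- A chess tableau is strictly increasing down columns, by parity. -/
theorem IsChessTableau.col_lt {l : ℕ → ℕ} (hl : IsPartition l) {i k : ℕ} {j : ℕ → ℕ}
    {S : ℕ × ℕ → ℕ} (hS : IsChessTableau l i k j S) {s s' t : ℕ} (hss : s < s')
    (hb : (s', t) ∈ boxes l) : S (s, t) < S (s', t) := by
  obtain ⟨-, -, -, hcol, hpar⟩ := hS
  have hb1 : (s + 1, t) ∈ boxes l := mem_boxes_of_le hl hss le_rfl hb
  have h0 := hpar _ (mem_boxes_of_le hl hss.le le_rfl hb)
  have h1 := hpar _ hb1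
  have hstep := hcol s (s + 1) t (by omega) hb1
  have hle : S (s + 1, t) ≤ S (s', t) := by
    rcases (show s + 1 ≤ s' from hss).eq_or_lt with h | h
    · rw [h]
    · exact hcol _ _ _ h hb
  simp only [boxParity] at h0 h1
  omega

/-- Any bijective labelling lying over a chess tableau is standard. -/
theorem mem_tabSet_of_sigmaOf_eq {l : ℕ → ℕ} (hl : IsPartition l) {n i k : ℕ}
    {ii j d : ℕ → ℕ} (hii : Alternating k ii) (hjsum : ∑ t ∈ Finset.Icc 1 k, j t = n)
    (hd : ∀ t, 1 ≤ t → t ≤ n → d t = ii (sigmaOf j t)) {S T : ℕ × ℕ → ℕ}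
    (hS : IsChessTableau l ((i + ii 1 + 1) % 2) k j S)
    (hbij : Set.BijOn T (boxes l) (Set.Icc 1 n)) (hzero : ∀ b ∉ boxes l, T b = 0)
    (hST : ∀ b ∈ boxes l, sigmaOf j (T b) = S b) : T ∈ TabSet l n i d := by
  have hlt : ∀ a ∈ boxes l, ∀ b ∈ boxes l, S a < S b → T a < T b := by
    intro a ha b hb hab
    by_contra h
    have := sigmaOf_mono (not_lt.mp h) (hjsum ▸ (hbij.mapsTo ha).2)
    rw [hST a ha, hST b hb] at this
    omega
  refine ⟨⟨hbij, fun s t t' h hb => ?_, fun s s' t h hb => ?_⟩, hzero, fun b hb => ?_⟩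
  · exact hlt _ (mem_boxes_of_le hl le_rfl h.le hb) _ hb (hS.2.2.1 s t t' h hb)
  · exact hlt _ (mem_boxes_of_le hl h.le le_rfl hb) _ hb (hS.col_lt hl h hb)
  · rw [boxParity_eq_iff hii hjsum hd i b.1 b.2 (hbij.mapsTo hb), hST b hb]
    exact hS.2.2.2.2 b hb

open Classical in
/-- The extension by zero of a labelling given on a set of boxes. -/
noncomputable def extendByZero {B : Set (ℕ × ℕ)} (e : B → ℕ) : ℕ × ℕ → ℕ :=
  fun b => if h : b ∈ B then e ⟨b, h⟩ else 0

theorem extendByZero_of_mem {B : Set (ℕ × ℕ)} (e : B → ℕ) {b : ℕ × ℕ} (h : b ∈ B) :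
    extendByZero e b = e ⟨b, h⟩ := dif_pos h

theorem extendByZero_of_notMem {B : Set (ℕ × ℕ)} (e : B → ℕ) {b : ℕ × ℕ} (h : b ∉ B) :
    extendByZero e b = 0 := dif_neg h

theorem bijOn_extendByZero {B : Set (ℕ × ℕ)} {C : Set ℕ} (e : B ≃ C) :
    Set.BijOn (extendByZero fun b => (e b : ℕ)) B C := by
  refine ⟨fun b hb => ?_, fun a ha b hb h => ?_, fun x hx => ?_⟩
  · rw [extendByZero_of_mem _ hb]
    exact (e _).2
  · rw [extendByZero_of_mem _ ha, extendByZero_of_mem _ hb] at h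
    exact congrArg Subtype.val (e.injective (Subtype.ext h))
  · refine ⟨e.symm ⟨x, hx⟩, (e.symm _).2, ?_⟩
    rw [extendByZero_of_mem _ (e.symm _).2]
    simp

/-- The number of bijections with a prescribed composite `B ≃ C → K` is a product of
factorials of the fiber sizes. -/
theorem card_equiv_over {B C K : Type*} [Finite B] [Finite C] [Fintype K] (f : B → K) (g : C → K)
    (hcard : ∀ t, Nat.card {b // f b = t} = Nat.card {c // g c = t}) :
    Nat.card {e : B ≃ C // g ∘ e = f} = ∏ t, (Nat.card {b // f b = t}).factorial := by
  classical
  have := Fintype.ofFinite B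
  let e₀ : B ≃ C := Equiv.ofFiberEquiv (f := f) (g := g) fun t =>
    (Finite.card_eq.mp (hcard t)).some
  have he₀ : g ∘ e₀ = f := funext fun b => Equiv.ofFiberEquiv_map _ b
  have hequiv : {p : Equiv.Perm B // f ∘ p = f} ≃ {e : B ≃ C // g ∘ e = f} :=
    (Equiv.equivCongr (Equiv.refl B) e₀).subtypeEquiv fun p => by
      have : g ∘ (Equiv.equivCongr (Equiv.refl B) e₀ p) = (g ∘ e₀) ∘ p := rfl
      rw [this, he₀]
  rw [← Nat.card_congr hequiv, Nat.card_eq_fintype_card, DomMulAct.stabilizer_card]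
  simp only [Nat.card_eq_fintype_card]

theorem ncard_eq_mul_ncard_of_fibers {α β : Type*} {A : Set α} {B : Set β} {f : α → β} {m : ℕ}
    (hm : m ≠ 0) (hf : Set.MapsTo f A B) (hcard : ∀ b ∈ B, {a ∈ A | f a = b}.ncard = m) :
    A.ncard = m * B.ncard := by
  have hfib : ∀ b : B, Nonempty ({a : A // hf.restrict f A B a = b} ≃ Fin m) := by
    intro b
    have hb : Nat.card {a // a ∈ A ∧ f a = b} = m := hcard b b.2
    have := Nat.finite_of_card_ne_zero (hb.trans_ne hm)
    have e : {a : A // hf.restrict f A B a = b} ≃ {a // a ∈ A ∧ f a = b} :=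
      (Equiv.subtypeEquivRight fun a => by
        simp [Subtype.ext_iff]).trans
        (Equiv.subtypeSubtypeEquivSubtypeInter (· ∈ A) (fun a => f a = b))
    exact ⟨e.trans (Finite.equivFinOfCardEq hb)⟩
  have E : A ≃ B × Fin m :=
    (Equiv.sigmaFiberEquiv (hf.restrict f A B)).symm.trans
      ((Equiv.sigmaCongrRight fun b => (hfib b).some).trans (Equiv.sigmaEquivProd B (Fin m)))
  rw [← Nat.card_coe_set_eq, Nat.card_congr E, Nat.card_prod, Nat.card_fin, mul_comm,
    Nat.card_coe_set_eq]

theorem ncard_tabSet_fiber {l : ℕ → ℕ} (hl : IsPartition l) {n i k : ℕ}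
    {ii j d : ℕ → ℕ} (hii : Alternating k ii) (hjsum : ∑ t ∈ Finset.Icc 1 k, j t = n)
    (hd : ∀ t, 1 ≤ t → t ≤ n → d t = ii (sigmaOf j t)) {S : ℕ × ℕ → ℕ}
    (hS : S ∈ ChessSet l ((i + ii 1 + 1) % 2) k j) :
    {T ∈ TabSet l n i d | sigmaOf j ∘ T = S}.ncard =
      ∏ t ∈ Finset.Icc 1 k, (j t).factorial := by
  have := (finite_boxes hl).to_subtype
  let f : boxes l → Finset.Icc 1 k := fun b => ⟨S b, Finset.mem_Icc.mpr (hS.1.1 b b.2)⟩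
  let g : Set.Icc 1 n → Finset.Icc 1 k := fun x => ⟨sigmaOf j x, by
    have hx : (x : ℕ) ≤ ∑ t ∈ Finset.Icc 1 k, j t := hjsum ▸ x.2.2
    exact Finset.mem_Icc.mpr ⟨sigmaOf_pos x.2.1 hx, (sigmaOf_le_iff hx k).mpr hx⟩⟩
  have hf : ∀ t, Nat.card {b // f b = t} = j t := by
    rintro ⟨t, ht⟩
    rw [Finset.mem_Icc] at ht
    rw [← hS.1.2.1 t ht.1 ht.2]
    exact Nat.card_congr ((Equiv.subtypeEquivRight fun b => by simp [f]).trans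
      (Equiv.subtypeSubtypeEquivSubtypeInter (· ∈ boxes l) (fun b => S b = t)))
  have hg : ∀ t, Nat.card {x // g x = t} = j t := by
    rintro ⟨t, ht⟩
    rw [Finset.mem_Icc] at ht
    rw [← ncard_sigmaOf_fiber (j := j) ht.1 ht.2, hjsum]
    exact Nat.card_congr ((Equiv.subtypeEquivRight fun x => by simp [g]).trans
      (Equiv.subtypeSubtypeEquivSubtypeInter (· ∈ Set.Icc 1 n) (fun x => sigmaOf j x = t)))
  have hcount := card_equiv_over f g fun t => (hf t).trans (hg t).symm
  simp only [hf] at hcount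
  rw [Finset.prod_coe_sort (Finset.Icc 1 k) fun t => (j t).factorial] at hcount
  rw [← hcount]
  symm
  refine Nat.card_congr (Equiv.ofBijective
    (fun e => ⟨extendByZero fun b => (e.1 b : ℕ), ?_⟩) ⟨?_, ?_⟩)
  · have hover : ∀ b ∈ boxes l, sigmaOf j (extendByZero (fun b => (e.1 b : ℕ)) b) = S b := by
      intro b hb
      rw [extendByZero_of_mem _ hb]
      exact congrArg Subtype.val (congrFun e.2 ⟨b, hb⟩)
    refine ⟨mem_tabSet_of_sigmaOf_eq hl hii hjsum hd hS.1 (bijOn_extendByZero e.1)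
      (fun b hb => extendByZero_of_notMem _ hb) hover, funext fun b => ?_⟩
    by_cases hb : b ∈ boxes l
    · exact hover b hb
    · simp [extendByZero_of_notMem _ hb, sigmaOf_zero, hS.2 b hb]
  · intro e e' h
    refine Subtype.ext (Equiv.ext fun b => Subtype.ext ?_)
    have := congrFun (congrArg Subtype.val h) b
    simpa [extendByZero_of_mem _ b.2] using this
  · rintro ⟨T, hT, hTS⟩
    refine ⟨⟨hT.1.1.equiv T, funext fun b => Subtype.ext (congrFun hTS b)⟩, Subtype.ext ?_⟩
    change extendByZero (fun b : boxes l => T b) = T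
    funext b
    by_cases hb : b ∈ boxes l
    · exact extendByZero_of_mem _ hb
    · rw [hT.2.1 b hb]
      exact extendByZero_of_notMem _ hb


theorem card_tab_eq_factorials_mul_card_chess
    (l : ℕ → ℕ) (hl : IsPartition l) (n : ℕ) (hn : psize l = n)
    (i : ℕ) (hi : i ≤ 1) (k : ℕ) (ii : ℕ → ℕ) (hii : Alternating k ii)
    (j : ℕ → ℕ) (hjsum : ∑ t ∈ Finset.Icc 1 k, j t = n)
    (d : ℕ → ℕ) (hd : ∀ t, 1 ≤ t → t ≤ n → d t = ii (sigmaOf j t)) :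
    (TabSet l n i d).ncard =
      (∏ t ∈ Finset.Icc 1 k, Nat.factorial (j t)) *
        (ChessSet l ((i + ii 1 + 1) % 2) k j).ncard := by
  exact ncard_eq_mul_ncard_of_fibers (f := fun T => sigmaOf j ∘ T)
    (Finset.prod_ne_zero_iff.mpr fun t _ => (j t).factorial_ne_zero)
    (fun _ hT => sigmaOf_comp_mem_chessSet hl hii hjsum hd hT)
    (fun _ hS => ncard_tabSet_fiber hl hii hjsum hd hS)
end

section
/- Let λ be a partition of n, let i ∈ {0,1}, let d ∈ {0,1}ⁿ, let M = M(λ,i) be the shape module, let δ = α + β (so δ v_{s,t} = v_{s,t−1}, with v_{s,−1} := 0), and let T be a standard tableau of shape λ. For 0 ≤ t ≤ n let λ^{(t)} denote the partition whose Young diagram consists of the boxes of T with labels ≤ t. Then there exists a Λ-composition series (V_t)_{0≤t≤n} of M of type d such that for every 0 ≤ t ≤ n and every m ≥ 1 one has dim(V_t ∩ ker δ^m) = Σ_s min(λ^{(t)}_s, m) (i.e. the nilpotent operator δ restricted to V_t has Jordan type λ^{(t)}) if and only if the i-parity of T equals d. -/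
/-- The ambient vector space with basis indexed by `ℕ × ℕ`. -/
abbrev Amb : Type := (ℕ × ℕ) →₀ ℂ

/-- The basis vector `v_{s,t}`. -/
noncomputable def vB (b : ℕ × ℕ) : Amb := Finsupp.single b 1

/-- `α`: on `v_{s,t}` with `s+t+i` even gives `v_{s,t-1}` (0 if `t = 0`), else 0. -/
noncomputable def opAlpha (i : ℕ) : Amb →ₗ[ℂ] Amb :=
  Finsupp.lift _ ℂ _ fun b =>
    if boxParity i b.1 b.2 = 0 ∧ 1 ≤ b.2 then vB (b.1, b.2 - 1) else 0

/-- `β`: on `v_{s,t}` with `s+t+i` odd gives `v_{s,t-1}` (0 if `t = 0`), else 0. -/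
noncomputable def opBeta (i : ℕ) : Amb →ₗ[ℂ] Amb :=
  Finsupp.lift _ ℂ _ fun b =>
    if boxParity i b.1 b.2 = 1 ∧ 1 ≤ b.2 then vB (b.1, b.2 - 1) else 0

/-- `α*`: on `v_{s,t}` with `s+t+i` odd gives `v_{s-1,t}` (0 if `s = 0`), else 0. -/
noncomputable def opAlphaStar (i : ℕ) : Amb →ₗ[ℂ] Amb :=
  Finsupp.lift _ ℂ _ fun b =>
    if boxParity i b.1 b.2 = 1 ∧ 1 ≤ b.1 then vB (b.1 - 1, b.2) else 0

/-- `β*`: on `v_{s,t}` with `s+t+i` even gives `v_{s-1,t}` (0 if `s = 0`), else 0. -/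
noncomputable def opBetaStar (i : ℕ) : Amb →ₗ[ℂ] Amb :=
  Finsupp.lift _ ℂ _ fun b =>
    if boxParity i b.1 b.2 = 0 ∧ 1 ≤ b.1 then vB (b.1 - 1, b.2) else 0

/-- `δ = α + β`. -/
noncomputable def opDelta (i : ℕ) : Amb →ₗ[ℂ] Amb := opAlpha i + opBeta i

/-- The shape module `M(λ, i)`, realised as the span of the box vectors. -/
noncomputable def shapeModule (l : ℕ → ℕ) : Submodule ℂ Amb :=
  Submodule.span ℂ (vB '' boxes l)

/-- `E_p`: the span of the box vectors of `i`-parity `p`. -/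
noncomputable def Epart (l : ℕ → ℕ) (i p : ℕ) : Submodule ℂ Amb :=
  Submodule.span ℂ (vB '' {b ∈ boxes l | boxParity i b.1 b.2 = p})

/-- Stability of a subspace under the four operators. -/
def LamStable (i : ℕ) (V : Submodule ℂ Amb) : Prop :=
  (∀ x ∈ V, opAlpha i x ∈ V) ∧ (∀ x ∈ V, opBeta i x ∈ V) ∧
  (∀ x ∈ V, opAlphaStar i x ∈ V) ∧ (∀ x ∈ V, opBetaStar i x ∈ V)

/-- `V` is a Λ-submodule of `M(λ,i)`. -/
def IsLamSubmodule (l : ℕ → ℕ) (i : ℕ) (V : Submodule ℂ Amb) : Prop :=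
  V ≤ shapeModule l ∧ LamStable i V ∧ V = (V ⊓ Epart l i 0) ⊔ (V ⊓ Epart l i 1)

/-- A Λ-composition series of `M(λ,i)` of type `d`. -/
def IsCompSeries (l : ℕ → ℕ) (i n : ℕ) (d : ℕ → ℕ) (V : ℕ → Submodule ℂ Amb) : Prop :=
  V 0 = ⊥ ∧ V n = shapeModule l ∧
  (∀ t, 1 ≤ t → t ≤ n → V (t - 1) ≤ V t) ∧
  (∀ t, t ≤ n → IsLamSubmodule l i (V t)) ∧
  (∀ t, t ≤ n → Module.finrank ℂ (V t) = t) ∧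
  (∀ t, 1 ≤ t → t ≤ n →
    Module.finrank ℂ (V t ⊓ Epart l i (d t) : Submodule ℂ Amb) =
      Module.finrank ℂ (V (t - 1) ⊓ Epart l i (d t) : Submodule ℂ Amb) + 1)

/-- `λ^{(r)}_s`: the number of boxes of row `s` of `T` with label at most `r`. -/
noncomputable def subShape (l : ℕ → ℕ) (T : ℕ × ℕ → ℕ) (r s : ℕ) : ℕ :=
  {c : ℕ | c < l s ∧ T (s, c) ≤ r}.ncard

/-! Statement 5: there is a Λ-composition series of type `d` whose `r`-th
member meets each `ker δ^m` in dimension `Σ_s min(λ^{(r)}_s, m)` (i.e. `δ`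
restricted to `V r` has Jordan type `λ^{(r)}`) iff the `i`-parity of `T`
equals `d`. -/

theorem boxParity_lt_two (i s t : ℕ) : boxParity i s t < 2 := Nat.mod_lt _ (by norm_num)

theorem opAlpha_apply (i : ℕ) (x : Amb) (s t : ℕ) :
    opAlpha i x (s, t) = if boxParity i s (t + 1) = 0 then x (s, t + 1) else 0 := by
  induction x using Finsupp.induction_linear with
  | zero => simp
  | add f g hf hg => rw [map_add, Finsupp.add_apply, hf, hg]; split_ifs <;> simp
  | single a c =>
    obtain ⟨a, b⟩ := a
    rcases b with _ | b
    · simp [opAlpha]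
    · by_cases h : a = s ∧ b = t
      · obtain ⟨rfl, rfl⟩ := h
        simp only [opAlpha, vB]
        split_ifs <;> simp_all
      · by_cases hp : boxParity i a (b + 1) = 0 <;>
          simp [opAlpha, vB, hp, h]

theorem opBeta_apply (i : ℕ) (x : Amb) (s t : ℕ) :
    opBeta i x (s, t) = if boxParity i s (t + 1) = 1 then x (s, t + 1) else 0 := by
  induction x using Finsupp.induction_linear with
  | zero => simp
  | add f g hf hg => rw [map_add, Finsupp.add_apply, hf, hg]; split_ifs <;> simp
  | single a c =>
    obtain ⟨a, b⟩ := a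
    rcases b with _ | b
    · simp [opBeta]
    · by_cases h : a = s ∧ b = t
      · obtain ⟨rfl, rfl⟩ := h
        simp only [opBeta, vB]
        split_ifs <;> simp_all
      · by_cases hp : boxParity i a (b + 1) = 1 <;>
          simp [opBeta, vB, hp, h]

theorem opAlphaStar_apply (i : ℕ) (x : Amb) (s t : ℕ) :
    opAlphaStar i x (s, t) = if boxParity i (s + 1) t = 1 then x (s + 1, t) else 0 := by
  induction x using Finsupp.induction_linear with
  | zero => simp
  | add f g hf hg => rw [map_add, Finsupp.add_apply, hf, hg]; split_ifs <;> simp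
  | single a c =>
    obtain ⟨a, b⟩ := a
    rcases a with _ | a
    · simp [opAlphaStar]
    · by_cases h : a = s ∧ b = t
      · obtain ⟨rfl, rfl⟩ := h
        simp only [opAlphaStar, vB]
        split_ifs <;> simp_all
      · by_cases hp : boxParity i (a + 1) b = 1 <;>
          simp [opAlphaStar, vB, hp, h]

theorem opBetaStar_apply (i : ℕ) (x : Amb) (s t : ℕ) :
    opBetaStar i x (s, t) = if boxParity i (s + 1) t = 0 then x (s + 1, t) else 0 := by
  induction x using Finsupp.induction_linear with
  | zero => simp
  | add f g hf hg => rw [map_add, Finsupp.add_apply, hf, hg]; split_ifs <;> simp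
  | single a c =>
    obtain ⟨a, b⟩ := a
    rcases a with _ | a
    · simp [opBetaStar]
    · by_cases h : a = s ∧ b = t
      · obtain ⟨rfl, rfl⟩ := h
        simp only [opBetaStar, vB]
        split_ifs <;> simp_all
      · by_cases hp : boxParity i (a + 1) b = 0 <;>
          simp [opBetaStar, vB, hp, h]

theorem opDelta_apply (i : ℕ) (x : Amb) (s t : ℕ) : opDelta i x (s, t) = x (s, t + 1) := by
  have := boxParity_lt_two i s (t + 1)
  rw [opDelta, LinearMap.add_apply, Finsupp.add_apply, opAlpha_apply, opBeta_apply]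
  rcases (by omega : boxParity i s (t + 1) = 0 ∨ boxParity i s (t + 1) = 1) with h | h <;> simp [h]

theorem opAlphaStar_add_opBetaStar_apply (i : ℕ) (x : Amb) (s t : ℕ) :
    (opAlphaStar i x + opBetaStar i x) (s, t) = x (s + 1, t) := by
  have := boxParity_lt_two i (s + 1) t
  rw [Finsupp.add_apply, opAlphaStar_apply, opBetaStar_apply]
  rcases (by omega : boxParity i (s + 1) t = 0 ∨ boxParity i (s + 1) t = 1) with h | h <;> simp [h]

theorem opDelta_pow_apply (i m : ℕ) (x : Amb) (s t : ℕ) :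
    (opDelta i ^ m) x (s, t) = x (s, t + m) := by
  induction m generalizing t with
  | zero => simp
  | succ m ih =>
    rw [pow_succ', Module.End.mul_apply, opDelta_apply, ih]
    congr 2
    omega

theorem ker_opDelta_pow (i m : ℕ) :
    LinearMap.ker (opDelta i ^ m) = Finsupp.supported ℂ ℂ {b : ℕ × ℕ | b.2 < m} := by
  ext x
  rw [LinearMap.mem_ker, Finsupp.mem_supported']
  constructor
  · rintro h ⟨s, t⟩ hb
    obtain ⟨k, rfl⟩ := Nat.exists_eq_add_of_le (not_lt.mp hb : m ≤ t)
    rw [add_comm, ← opDelta_pow_apply i, h, Finsupp.zero_apply]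
  · intro h
    ext ⟨s, t⟩
    rw [opDelta_pow_apply]
    exact h _ (by simp)

theorem shapeModule_eq_supported (l : ℕ → ℕ) :
    shapeModule l = Finsupp.supported ℂ ℂ (boxes l) :=
  (Finsupp.supported_eq_span_single ℂ _).symm

theorem Epart_eq_supported (l : ℕ → ℕ) (i p : ℕ) :
    Epart l i p = Finsupp.supported ℂ ℂ {b ∈ boxes l | boxParity i b.1 b.2 = p} :=
  (Finsupp.supported_eq_span_single ℂ _).symm

/-- The order on boxes: by column, then by row. -/
def colKey (b : ℕ × ℕ) : ℕ ×ₗ ℕ := toLex (b.2, b.1)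

theorem colKey_le_iff (a b : ℕ × ℕ) :
    colKey a ≤ colKey b ↔ a.2 < b.2 ∨ a.2 = b.2 ∧ a.1 ≤ b.1 := by
  simp [colKey, Prod.Lex.toLex_le_toLex]

theorem colKey_injective : Function.Injective colKey := by
  rintro ⟨a, b⟩ ⟨c, d⟩ h
  simpa [colKey, and_comm] using h

/-- The set of positions of leading terms, with respect to `colKey`, of elements of `V`. -/
def lead (V : Submodule ℂ Amb) : Set (ℕ × ℕ) :=
  {b | ∃ x ∈ V, x b ≠ 0 ∧ ∀ c, x c ≠ 0 → colKey c ≤ colKey b}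

theorem lead_subset {V : Submodule ℂ Amb} {S : Set (ℕ × ℕ)} (h : V ≤ Finsupp.supported ℂ ℂ S) :
    lead V ⊆ S := by
  rintro b ⟨x, hx, hb, -⟩
  by_contra hbS
  exact hb ((Finsupp.mem_supported' ℂ x).mp (h hx) b hbS)

theorem lead_supported (S : Set (ℕ × ℕ)) : lead (Finsupp.supported ℂ ℂ S) = S := by
  refine (lead_subset le_rfl).antisymm fun b hb => ⟨Finsupp.single b 1, ?_, by simp, ?_⟩
  · exact Finsupp.single_mem_supported ℂ _ hb
  · intro c hc
    rw [Finsupp.single_apply] at hc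
    split_ifs at hc with h
    · rw [h]
    · exact absurd rfl hc

theorem finrank_eq_ncard_lead_of_finset (S : Finset (ℕ × ℕ)) :
    ∀ V : Submodule ℂ Amb, V ≤ Finsupp.supported ℂ ℂ (S : Set (ℕ × ℕ)) →
      Module.finrank ℂ V = (lead V).ncard := by
  induction S using Finset.induction_on_max_value colKey with
  | empty =>
    intro V hV
    have h0 : lead V = ∅ := by simpa using lead_subset hV
    have : V = ⊥ := by simpa using hV
    rw [h0, this]
    simp
  | insert a S ha hmax ih =>
    intro V hV
    have hfin : FiniteDimensional ℂ V := by
      have : FiniteDimensional ℂ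
          (Finsupp.supported ℂ ℂ ((insert a S : Finset (ℕ × ℕ)) : Set (ℕ × ℕ))) :=
        Module.Finite.equiv (Finsupp.supportedEquivFinsupp _).symm
      exact Submodule.finiteDimensional_of_le hV
    let φ : V →ₗ[ℂ] ℂ := (Finsupp.lapply a).comp V.subtype
    let V' : Submodule ℂ Amb := (LinearMap.ker φ).map V.subtype
    have hV'mem : ∀ x, x ∈ V' ↔ x ∈ V ∧ x a = 0 := by
      intro x
      simp [V', φ, Submodule.mem_map, and_comm]
    have hV' : V' ≤ Finsupp.supported ℂ ℂ (S : Set (ℕ × ℕ)) := by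
      intro x hx
      obtain ⟨hx, hxa⟩ := (hV'mem x).mp hx
      rw [Finsupp.mem_supported']
      intro b hb
      by_cases hba : b = a
      · rw [hba, hxa]
      · exact (Finsupp.mem_supported' ℂ x).mp (hV hx) b (by simpa [hba] using hb)
    have hrank : Module.finrank ℂ V' = Module.finrank ℂ (LinearMap.ker φ) :=
      (LinearEquiv.finrank_eq
        (Submodule.equivMapOfInjective _ V.injective_subtype (LinearMap.ker φ))).symm
    have hrn := LinearMap.finrank_range_add_finrank_ker (K := ℂ) (V := V) (V₂ := ℂ) φ
    rw [← hrank, ih V' hV'] at hrn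
    have haV' : a ∉ lead V' := fun h => ha (lead_subset hV' h)
    have hleadV' : lead V' = lead V \ {a} := by
      ext b
      constructor
      · intro hb
        refine ⟨?_, fun h => haV' (h ▸ hb)⟩
        obtain ⟨x, hx, h⟩ := hb
        exact ⟨x, ((hV'mem x).mp hx).1, h⟩
      · rintro ⟨⟨x, hx, hb, hc⟩, hba⟩
        refine ⟨x, (hV'mem x).mpr ⟨hx, ?_⟩, hb, hc⟩
        by_contra hxa
        have hbS : b ∈ S := by
          have := lead_subset hV ⟨x, hx, hb, hc⟩
          simpa [show b ≠ a from hba] using this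
        exact hba (colKey_injective ((hmax b hbS).antisymm (hc a hxa)))
    by_cases hφ : ∃ x ∈ V, x a ≠ 0
    · obtain ⟨x, hx, hxa⟩ := hφ
      have hsurj : LinearMap.range φ = ⊤ := by
        refine LinearMap.range_eq_top.mpr (LinearMap.surjective ?_)
        intro h
        exact hxa (by simpa [φ] using LinearMap.congr_fun h ⟨x, hx⟩)
      have haV : a ∈ lead V := by
        refine ⟨x, hx, hxa, fun c hc => ?_⟩
        have : c ∈ insert a S := by
          by_contra h
          exact hc ((Finsupp.mem_supported' ℂ x).mp (hV hx) c (by simpa using h))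
        rcases Finset.mem_insert.mp this with rfl | h
        · exact le_rfl
        · exact hmax c h
      rw [hsurj, finrank_top, Module.finrank_self, hleadV'] at hrn
      have hf : (lead V).Finite := (insert a S).finite_toSet.subset (lead_subset hV)
      rw [← Set.ncard_sdiff_singleton_add_one haV hf, ← hrn, add_comm]
    · push Not at hφ
      have h0 : φ = 0 := by
        ext x
        exact hφ x x.2
      rw [h0, LinearMap.range_zero, finrank_bot, zero_add, hleadV',
        Set.sdiff_singleton_eq_self] at hrn
      · exact hrn.symm
      · rintro ⟨x, hx, h, -⟩
        exact h (hφ x hx)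

/-- The dimension of a finitely supported space is its number of leading positions. -/
theorem finrank_eq_ncard_lead {V : Submodule ℂ Amb} {S : Set (ℕ × ℕ)} (hS : S.Finite)
    (hV : V ≤ Finsupp.supported ℂ ℂ S) : Module.finrank ℂ V = (lead V).ncard :=
  finrank_eq_ncard_lead_of_finset hS.toFinset V (by simpa using hV)

theorem finrank_supported_eq_ncard {S : Set (ℕ × ℕ)} (hS : S.Finite) :
    Module.finrank ℂ (Finsupp.supported ℂ ℂ S) = S.ncard := by
  rw [finrank_eq_ncard_lead hS le_rfl, lead_supported]

theorem lead_inf_ker (V : Submodule ℂ Amb) (i m : ℕ) :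
    lead (V ⊓ LinearMap.ker (opDelta i ^ m)) = lead V ∩ {b | b.2 < m} := by
  rw [ker_opDelta_pow]
  ext b
  constructor
  · intro hb
    refine ⟨?_, lead_subset inf_le_right hb⟩
    obtain ⟨x, hx, h⟩ := hb
    exact ⟨x, hx.1, h⟩
  · rintro ⟨⟨x, hx, hb, hc⟩, hbm⟩
    refine ⟨x, ⟨hx, (Finsupp.mem_supported' ℂ x).mpr fun c hcm => ?_⟩, hb, hc⟩
    by_contra h
    have := (colKey_le_iff _ _).mp (hc c h)
    simp only [Set.mem_ofPred_eq] at hbm hcm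
    omega

theorem lead_inf_Epart {l : ℕ → ℕ} {i : ℕ} {V : Submodule ℂ Amb} (hV : IsLamSubmodule l i V)
    {p : ℕ} (hp : p ≤ 1) :
    lead (V ⊓ Epart l i p) = lead V ∩ {b | boxParity i b.1 b.2 = p} := by
  ext b
  constructor
  · intro hb
    refine ⟨?_, (lead_subset (inf_le_right.trans (Epart_eq_supported l i p).le) hb).2⟩
    obtain ⟨x, hx, h⟩ := hb
    exact ⟨x, hx.1, h⟩
  · rintro ⟨⟨x, hx, hb, hc⟩, hbp⟩
    have key : ∃ y ∈ V ⊓ Epart l i p, ∃ z ∈ Epart l i (1 - p), y + z = x := by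
      rw [hV.2.2] at hx
      obtain ⟨y, hy, z, hz, h⟩ := Submodule.mem_sup.mp hx
      interval_cases p
      · exact ⟨y, hy, z, hz.2, h⟩
      · exact ⟨z, hz, y, hy.2, by rw [add_comm, h]⟩
    obtain ⟨y, hy, z, hz, rfl⟩ := key
    have hy' : y ∈ Epart l i p := hy.2
    rw [Epart_eq_supported, Finsupp.mem_supported'] at hy' hz
    have hz0 : ∀ c : ℕ × ℕ, boxParity i c.1 c.2 = p → z c = 0 := fun c h =>
      hz c fun h' => by have := h'.2; omega
    refine ⟨y, hy, by simpa [hz0 b hbp] using hb, fun c h => hc c ?_⟩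
    have hcp : boxParity i c.1 c.2 = p := by
      by_contra hne
      exact h (hy' c fun h' => hne h'.2)
    simpa [hz0 c hcp] using h

theorem lead_row_pred {i : ℕ} {V : Submodule ℂ Amb} (hV : LamStable i V) {s t : ℕ}
    (h : (s + 1, t) ∈ lead V) : (s, t) ∈ lead V := by
  obtain ⟨x, hx, hb, hc⟩ := h
  refine ⟨_, V.add_mem (hV.2.2.1 x hx) (hV.2.2.2 x hx), ?_, ?_⟩
  · rwa [opAlphaStar_add_opBetaStar_apply]
  · rintro ⟨a, b⟩ h
    rw [opAlphaStar_add_opBetaStar_apply] at h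
    have := (colKey_le_iff _ _).mp (hc _ h)
    rw [colKey_le_iff]
    simp only at this ⊢
    omega

theorem row_mem_of_le {A : Set (ℕ × ℕ)} (hA : ∀ s t, (s + 1, t) ∈ A → (s, t) ∈ A)
    {s s' t : ℕ} (h : s ≤ s') (hs : (s', t) ∈ A) : (s, t) ∈ A := by
  induction s', h using Nat.le_induction with
  | base => exact hs
  | succ k _ ih => exact ih (hA _ _ hs)

/-- A finite set closed under decreasing the row is determined by the numbers of its elements in
the first `m` columns. -/
theorem eq_of_ncard_columns_eq {A B : Set (ℕ × ℕ)} (hAf : A.Finite) (hBf : B.Finite)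
    (hA : ∀ s t, (s + 1, t) ∈ A → (s, t) ∈ A) (hB : ∀ s t, (s + 1, t) ∈ B → (s, t) ∈ B)
    (h : ∀ m : ℕ, (A ∩ {b | b.2 < m}).ncard = (B ∩ {b | b.2 < m}).ncard) : A = B := by
  have hsplit : ∀ {C : Set (ℕ × ℕ)}, C.Finite → ∀ m : ℕ,
      (C ∩ {b | b.2 < m + 1}).ncard = (C ∩ {b | b.2 < m}).ncard + (C ∩ {b | b.2 = m}).ncard := by
    intro C hC m
    rw [← Set.ncard_union_eq _ (hC.inter_of_left _) (hC.inter_of_left _),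
      ← Set.inter_union_distrib_left]
    · congr 2
      ext b
      simp only [Set.mem_ofPred_eq, Set.mem_union]
      omega
    · rw [Set.disjoint_left]
      rintro b ⟨-, h1⟩ ⟨-, h2⟩
      simp only [Set.mem_ofPred_eq] at h1 h2
      omega
  have hcol : ∀ m : ℕ, (A ∩ {b | b.2 = m}).ncard = (B ∩ {b | b.2 = m}).ncard := by
    intro m
    have h1 := h (m + 1)
    rw [hsplit hAf, hsplit hBf, h m] at h1
    omega
  have hsub : ∀ {C D : Set (ℕ × ℕ)}, C.Finite → D.Finite →
      (∀ s t, (s + 1, t) ∈ C → (s, t) ∈ C) → (∀ s t, (s + 1, t) ∈ D → (s, t) ∈ D) →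
      (∀ m : ℕ, (C ∩ {b | b.2 = m}).ncard = (D ∩ {b | b.2 = m}).ncard) → C ⊆ D := by
    rintro C D hCf hDf hC hD hcol ⟨s, t⟩ hst
    by_contra hn
    have hss : D ∩ {b | b.2 = t} ⊂ C ∩ {b | b.2 = t} := by
      refine (Set.ssubset_iff_of_subset ?_).mpr ⟨(s, t), ⟨hst, rfl⟩, fun h => hn h.1⟩
      rintro ⟨a, b⟩ ⟨hab, hb⟩
      obtain rfl : b = t := hb
      refine ⟨?_, rfl⟩
      rcases le_total s a with h | h
      · exact absurd (row_mem_of_le hD h hab) hn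
      · exact row_mem_of_le hC h hst
    exact absurd (hcol t) (Set.ncard_lt_ncard hss (hCf.inter_of_left _)).ne'
  exact (hsub hAf hBf hA hB hcol).antisymm (hsub hBf hAf hB hA fun m => (hcol m).symm)

theorem ncard_boxes_eq_finsum {f : ℕ → ℕ} {N : ℕ} (hf : ∀ s, N ≤ s → f s = 0) :
    (boxes f).ncard = ∑ᶠ s, f s := by
  have hset : boxes f =
      (((Finset.range N).sigma fun s => Finset.range (f s)).map
        (Equiv.sigmaEquivProd ℕ ℕ).toEmbedding : Finset (ℕ × ℕ)) := by
    ext ⟨s, t⟩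
    have : t < f s → s < N := fun h => by
      by_contra hs
      rw [hf s (not_lt.mp hs)] at h
      omega
    simp only [boxes, Set.mem_ofPred_eq, Finset.coe_map, Set.mem_image, Finset.mem_coe,
      Finset.mem_sigma, Finset.mem_range]
    constructor
    · exact fun h => ⟨⟨s, t⟩, ⟨this h, h⟩, rfl⟩
    · rintro ⟨⟨a, b⟩, ⟨-, h⟩, hab⟩
      obtain ⟨rfl, rfl⟩ := Prod.mk.inj hab
      exact h
  rw [hset, Set.ncard_coe_finset, Finset.card_map, Finset.card_sigma,
    finsum_eq_sum_of_support_subset (s := Finset.range N)]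
  · simp
  · intro s hs
    by_contra h
    exact hs (hf s (by simpa using h))

/-- The boxes of `T` with labels at most `r`. -/
def labelBoxes (l : ℕ → ℕ) (T : ℕ × ℕ → ℕ) (r : ℕ) : Set (ℕ × ℕ) := {b ∈ boxes l | T b ≤ r}

section StandardTableau

variable {l : ℕ → ℕ} {n : ℕ} {T : ℕ × ℕ → ℕ}

theorem labelBoxes_subset (l : ℕ → ℕ) (T : ℕ × ℕ → ℕ) (r : ℕ) : labelBoxes l T r ⊆ boxes l :=
  Set.sep_subset _ _

theorem IsStandardTableau.finite_boxes (hT : IsStandardTableau l n T) : (boxes l).Finite :=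
  hT.1.finite_iff_finite.mpr (Set.finite_Icc 1 n)

theorem IsStandardTableau.labelBoxes_col_pred (hT : IsStandardTableau l n T) {r s t : ℕ}
    (h : (s, t + 1) ∈ labelBoxes l T r) : (s, t) ∈ labelBoxes l T r :=
  ⟨(Nat.lt_succ_self t).trans h.1, (hT.2.1 s t (t + 1) (Nat.lt_succ_self t) h.1).le.trans h.2⟩

theorem IsStandardTableau.labelBoxes_row_pred (hl : IsPartition l) (hT : IsStandardTableau l n T)
    {r s t : ℕ} (h : (s + 1, t) ∈ labelBoxes l T r) : (s, t) ∈ labelBoxes l T r :=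
  ⟨lt_of_lt_of_le (h.1 : t < l (s + 1)) (hl.1 s (s + 1) s.le_succ),
    (hT.2.2 s (s + 1) t s.lt_succ_self h.1).le.trans h.2⟩

theorem IsStandardTableau.lt_subShape_iff (hT : IsStandardTableau l n T) (r s t : ℕ) :
    t < subShape l T r s ↔ (s, t) ∈ labelBoxes l T r := by
  have hlow : ∀ a b, a ≤ b → (s, b) ∈ labelBoxes l T r → (s, a) ∈ labelBoxes l T r := by
    intro a b hab
    induction b, hab using Nat.le_induction with
    | base => exact id
    | succ k _ ih => exact fun h => ih (hT.labelBoxes_col_pred h)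
  have hfin : {c : ℕ | c < l s ∧ T (s, c) ≤ r}.Finite :=
    (Set.finite_Iio (l s)).subset fun c hc => hc.1
  constructor
  · intro h
    by_contra hn
    have hsub : {c : ℕ | c < l s ∧ T (s, c) ≤ r} ⊆ Set.Iio t := fun c hc => by
      by_contra hct
      exact hn (hlow t c (not_lt.mp hct) hc)
    have := Set.ncard_le_ncard hsub (Set.finite_Iio t)
    rw [Set.ncard_Iio_nat] at this
    exact absurd h (not_lt.mpr this)
  · intro h
    have hsub : Set.Iic t ⊆ {c : ℕ | c < l s ∧ T (s, c) ≤ r} := fun c hc => hlow c t hc h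
    have := Set.ncard_le_ncard hsub hfin
    rw [Set.ncard_Iic_nat] at this
    exact this

theorem IsStandardTableau.ncard_labelBoxes_inter (hl : IsPartition l)
    (hT : IsStandardTableau l n T) (r m : ℕ) :
    (labelBoxes l T r ∩ {b | b.2 < m}).ncard = ∑ᶠ s : ℕ, min (subShape l T r s) m := by
  obtain ⟨N, hN⟩ := hl.2
  rw [← ncard_boxes_eq_finsum (N := N)]
  · congr 1
    ext ⟨s, t⟩
    rw [boxes, Set.mem_ofPred_eq, lt_min_iff, hT.lt_subShape_iff]
    rfl
  · intro s hs
    simp [subShape, hN s hs]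

theorem IsStandardTableau.labelBoxes_eq_insert (hT : IsStandardTableau l n T) {b : ℕ × ℕ}
    (hb : b ∈ boxes l) : labelBoxes l T (T b) = insert b (labelBoxes l T (T b - 1)) := by
  have h1 : 1 ≤ T b := (hT.1.mapsTo hb).1
  ext c
  simp only [labelBoxes, Set.mem_insert_iff, Set.mem_ofPred_eq]
  constructor
  · rintro ⟨hc, h⟩
    rcases h.lt_or_eq with h | h
    · exact Or.inr ⟨hc, by omega⟩
    · exact Or.inl (hT.1.injOn hc hb h)
  · rintro (rfl | ⟨hc, h⟩)
    · exact ⟨hb, le_rfl⟩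
    · exact ⟨hc, by omega⟩

theorem IsStandardTableau.not_mem_labelBoxes_pred (hT : IsStandardTableau l n T) {b : ℕ × ℕ}
    (hb : b ∈ boxes l) : b ∉ labelBoxes l T (T b - 1) := fun h => by
  have h1 : 1 ≤ T b := (hT.1.mapsTo hb).1
  have := h.2
  omega

theorem IsStandardTableau.ncard_labelBoxes (hT : IsStandardTableau l n T) {r : ℕ} (hr : r ≤ n) :
    (labelBoxes l T r).ncard = r := by
  have himg : T '' labelBoxes l T r = Set.Icc 1 r := by
    ext k
    constructor
    · rintro ⟨b, hb, rfl⟩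
      exact ⟨(hT.1.mapsTo hb.1).1, hb.2⟩
    · rintro ⟨h1, h2⟩
      obtain ⟨b, hb, rfl⟩ := hT.1.surjOn ⟨h1, h2.trans hr⟩
      exact ⟨b, ⟨hb, h2⟩, rfl⟩
  rw [← (hT.1.injOn.mono (labelBoxes_subset l T r)).ncard_image, himg]
  simp [← Finset.coe_Icc, Set.ncard_coe_finset]

theorem IsStandardTableau.isLamSubmodule_supported (hl : IsPartition l)
    (hT : IsStandardTableau l n T) (i r : ℕ) :
    IsLamSubmodule l i (Finsupp.supported ℂ ℂ (labelBoxes l T r)) := by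
  refine ⟨?_, ⟨?_, ?_, ?_, ?_⟩, ?_⟩
  · rw [shapeModule_eq_supported]
    exact Finsupp.supported_mono (labelBoxes_subset l T r)
  · intro x hx
    rw [Finsupp.mem_supported'] at hx ⊢
    rintro ⟨s, t⟩ h
    rw [opAlpha_apply, hx _ fun h' => h (hT.labelBoxes_col_pred h'), ite_self]
  · intro x hx
    rw [Finsupp.mem_supported'] at hx ⊢
    rintro ⟨s, t⟩ h
    rw [opBeta_apply, hx _ fun h' => h (hT.labelBoxes_col_pred h'), ite_self]
  · intro x hx
    rw [Finsupp.mem_supported'] at hx ⊢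
    rintro ⟨s, t⟩ h
    rw [opAlphaStar_apply, hx _ fun h' => h (hT.labelBoxes_row_pred hl h'), ite_self]
  · intro x hx
    rw [Finsupp.mem_supported'] at hx ⊢
    rintro ⟨s, t⟩ h
    rw [opBetaStar_apply, hx _ fun h' => h (hT.labelBoxes_row_pred hl h'), ite_self]
  · rw [Epart_eq_supported, Epart_eq_supported, ← Finsupp.supported_inter,
      ← Finsupp.supported_inter, ← Finsupp.supported_union]
    congr 1
    ext ⟨s, t⟩
    have := boxParity_lt_two i s t
    constructor
    · intro h
      rcases (by omega : boxParity i s t = 0 ∨ boxParity i s t = 1) with h' | h'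
      · exact Or.inl ⟨h, h.1, h'⟩
      · exact Or.inr ⟨h, h.1, h'⟩
    · rintro (h | h) <;> exact h.1

theorem IsStandardTableau.lead_eq_labelBoxes (hl : IsPartition l) (hT : IsStandardTableau l n T)
    {i r : ℕ} {V : Submodule ℂ Amb} (hV : IsLamSubmodule l i V)
    (hdim : ∀ m : ℕ, 1 ≤ m →
      Module.finrank ℂ (V ⊓ LinearMap.ker (opDelta i ^ m) : Submodule ℂ Amb) =
        ∑ᶠ s : ℕ, min (subShape l T r s) m) :
    lead V = labelBoxes l T r := by
  have hsupp : V ≤ Finsupp.supported ℂ ℂ (boxes l) := hV.1.trans (shapeModule_eq_supported l).le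
  refine eq_of_ncard_columns_eq (hT.finite_boxes.subset (lead_subset hsupp))
    (hT.finite_boxes.subset (labelBoxes_subset l T r)) (fun s t => lead_row_pred hV.2.1)
    (fun s t => hT.labelBoxes_row_pred hl) fun m => ?_
  rcases Nat.eq_zero_or_pos m with rfl | hm
  · simp
  · rw [hT.ncard_labelBoxes_inter hl, ← hdim m hm,
      finrank_eq_ncard_lead hT.finite_boxes (inf_le_left.trans hsupp), lead_inf_ker]

theorem IsStandardTableau.isCompSeries_supported (hl : IsPartition l)
    (hT : IsStandardTableau l n T) {i : ℕ} {d : ℕ → ℕ}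
    (hd : ∀ b ∈ boxes l, boxParity i b.1 b.2 = d (T b)) :
    IsCompSeries l i n d fun r => Finsupp.supported ℂ ℂ (labelBoxes l T r) := by
  have hfin : ∀ r, (labelBoxes l T r).Finite := fun r =>
    hT.finite_boxes.subset (labelBoxes_subset l T r)
  refine ⟨?_, ?_, ?_, fun t _ => hT.isLamSubmodule_supported hl i t, ?_, ?_⟩
  · have : labelBoxes l T 0 = ∅ :=
      (Set.ncard_eq_zero (hfin 0)).mp (hT.ncard_labelBoxes (Nat.zero_le n))
    simp only [this, Finsupp.supported_empty]
  · have : labelBoxes l T n = boxes l :=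
      (labelBoxes_subset l T n).antisymm fun b hb => ⟨hb, (hT.1.mapsTo hb).2⟩
    simp only [this, shapeModule_eq_supported]
  · intro t _ _
    exact Finsupp.supported_mono fun b hb => ⟨hb.1, hb.2.trans (Nat.sub_le t 1)⟩
  · intro t ht
    rw [finrank_supported_eq_ncard (hfin t), hT.ncard_labelBoxes ht]
  · intro t h1 ht
    obtain ⟨b, hb, rfl⟩ := hT.1.surjOn ⟨h1, ht⟩
    rw [Epart_eq_supported, ← Finsupp.supported_inter, ← Finsupp.supported_inter,
      finrank_supported_eq_ncard ((hfin _).inter_of_left _),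
      finrank_supported_eq_ncard ((hfin _).inter_of_left _), hT.labelBoxes_eq_insert hb,
      Set.insert_inter_of_mem
        (show b ∈ {b' ∈ boxes l | boxParity i b'.1 b'.2 = d (T b)} from ⟨hb, hd b hb⟩),
      Set.ncard_insert_of_notMem (fun h => hT.not_mem_labelBoxes_pred hb h.1)
        ((hfin _).inter_of_left _)]

end StandardTableau

theorem comp_series_of_tableau_type_iff_parity
    (l : ℕ → ℕ) (hl : IsPartition l) (n : ℕ) (hn : psize l = n)
    (i : ℕ) (hi : i ≤ 1) (d : ℕ → ℕ) (hd : ∀ t, d t ≤ 1)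
    (T : ℕ × ℕ → ℕ) (hT : IsStandardTableau l n T) :
    (∃ V : ℕ → Submodule ℂ Amb, IsCompSeries l i n d V ∧
      ∀ r ≤ n, ∀ m : ℕ, 1 ≤ m →
        Module.finrank ℂ
            (V r ⊓ LinearMap.ker (opDelta i ^ m) : Submodule ℂ Amb) =
          ∑ᶠ s : ℕ, min (subShape l T r s) m) ↔
    (∀ b ∈ boxes l, boxParity i b.1 b.2 = d (T b)) := by
  constructor
  · rintro ⟨V, ⟨-, -, -, hsub, -, hstep⟩, hdim⟩ b hb
    obtain ⟨h1, h2⟩ := hT.1.mapsTo hb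
    have hcard : ∀ r ≤ n, Module.finrank ℂ (V r ⊓ Epart l i (d (T b)) : Submodule ℂ Amb) =
        (labelBoxes l T r ∩ {b' | boxParity i b'.1 b'.2 = d (T b)}).ncard := by
      intro r hr
      rw [finrank_eq_ncard_lead hT.finite_boxes
          (inf_le_left.trans ((hsub r hr).1.trans (shapeModule_eq_supported l).le)),
        lead_inf_Epart (hsub r hr) (hd _), hT.lead_eq_labelBoxes hl (hsub r hr) (hdim r hr)]
    have hs := hstep (T b) h1 h2
    by_contra hne
    rw [hcard _ h2, hcard _ ((Nat.sub_le _ 1).trans h2), hT.labelBoxes_eq_insert hb,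
      Set.insert_inter_of_notMem
        (show b ∉ {b' : ℕ × ℕ | boxParity i b'.1 b'.2 = d (T b)} from hne)] at hs
    omega
  · intro h
    refine ⟨_, hT.isCompSeries_supported hl h, fun r _ m _ => ?_⟩
    rw [ker_opDelta_pow, ← Finsupp.supported_inter, finrank_supported_eq_ncard
      ((hT.finite_boxes.subset (labelBoxes_subset l T r)).inter_of_left _),
      hT.ncard_labelBoxes_inter hl]
end

section
/- Let λ be a partition with N = N_λ, let i ∈ {0,1}, let 𝐢 = (i₁,…,i_k) ∈ {0,1}^k be an alternating bit string, and let i* ∈ {0,1} be the parity of i + i₁ + 1. For a family π = (π₀,…,π_N) ∈ Path^{(i)}_𝐢(λ), let T_π be the filling of λ whose row n (for 0 ≤ n ≤ N) lists, in increasing order from left to right, the ascents of π_n. Then T_π is a chess tableau of shape λ and parity i*, the map π ↦ T_π is a bijection from Path^{(i)}_𝐢(λ) onto Chess^{(i*)}(λ) = ⊔_{j ∈ ℤ_{≥0}^k} Chess^{(i*)}_j(λ), and π ∈ Path^{(i)}_𝐢(λ; j) if and only if T_π has content j. -/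
/-- `N_λ = max({n | λ_n > 0} ∪ {0})`. -/
noncomputable def Nmax (l : ℕ → ℕ) : ℕ := sSup {n | 0 < l n}

def IsPath (ii : ℕ → ℕ) (k : ℕ) (p : ℕ → ℤ) : Prop :=
  ∀ t, 1 ≤ t → t ≤ k →
    p t = p (t - 1) ∨ (p t = p (t - 1) + 1 ∧ p (t - 1) % 2 = (ii t : ℤ))

def ascents (k : ℕ) (p : ℕ → ℤ) : Finset ℕ :=
  (Finset.Icc 1 k).filter fun t => p t = p (t - 1) + 1

/-- `Path^{(i)}_𝐢(λ)`: non-crossing families `(π_0,…,π_N)` of paths in `Γ_𝐢`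
with `π_n` running from source `i − n` to sink `λ_n + i − n`.  (Families are
normalised: paths are constant beyond step `k`, and rows beyond `N_λ` are 0.) -/
def PathFam (l : ℕ → ℕ) (i k : ℕ) (ii : ℕ → ℕ) : Set (ℕ → ℕ → ℤ) :=
  {π | (∀ n ≤ Nmax l, IsPath ii k (π n) ∧ π n 0 = (i : ℤ) - n ∧
          π n k = (l n : ℤ) + i - n ∧ (∀ t, k < t → π n t = π n k)) ∧
    (∀ n, Nmax l < n → π n = fun _ => 0) ∧
    (∀ t ≤ k, ∀ m ≤ Nmax l, ∀ n ≤ Nmax l, m ≠ n → π m t ≠ π n t)}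

/-- The filling `T_π`: row `n` lists the ascents of `π_n` in increasing order. -/
def tabOfPaths (k : ℕ) (π : ℕ → ℕ → ℤ) : ℕ × ℕ → ℕ :=
  fun b => ((ascents k (π b.1)).sort (· ≤ ·)).getD b.2 0

/-- Chess tableaux of shape `l` and parity `i` with labels in `{1,…,k}`
(arbitrary content), normalised to be `0` off the diagram. -/
def ChessAllSet (l : ℕ → ℕ) (i k : ℕ) : Set (ℕ × ℕ → ℕ) :=
  {T | (∀ b ∈ boxes l, 1 ≤ T b ∧ T b ≤ k) ∧
    (∀ s t t' : ℕ, t < t' → (s, t') ∈ boxes l → T (s, t) < T (s, t')) ∧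
    (∀ s s' t : ℕ, s < s' → (s', t) ∈ boxes l → T (s, t) ≤ T (s', t)) ∧
    (∀ b ∈ boxes l, T b % 2 = boxParity i b.1 b.2) ∧
    (∀ b ∉ boxes l, T b = 0)}

theorem IsPartition.le_Nmax_of_pos {l : ℕ → ℕ} (hl : IsPartition l) {n : ℕ} (hn : 0 < l n) :
    n ≤ Nmax l := by
  obtain ⟨-, N, hN⟩ := hl
  refine le_csSup ⟨N, fun m hm => ?_⟩ hn
  by_contra! h
  have := hN m h.le
  have hm' : 0 < l m := hm
  omega

theorem Alternating.mod_two {k : ℕ} {ii : ℕ → ℕ} (h : Alternating k ii) {t : ℕ} (h1 : 1 ≤ t)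
    (hk : t ≤ k) : ii t = (ii 1 + t + 1) % 2 := by
  induction t, h1 using Nat.le_induction with
  | base => have := h.1 1 le_rfl hk; omega
  | succ t h1 ih =>
    have := h.2 t h1 (by omega)
    have := h.1 1 le_rfl (by omega)
    have := ih (by omega)
    omega

theorem mem_ascents {k : ℕ} {p : ℕ → ℤ} {t : ℕ} :
    t ∈ ascents k p ↔ (1 ≤ t ∧ t ≤ k) ∧ p t = p (t - 1) + 1 := by
  simp [ascents]

theorem tabOfPaths_eq_nth (k : ℕ) (π : ℕ → ℕ → ℤ) (b : ℕ × ℕ) :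
    tabOfPaths k π b = Nat.nth (· ∈ ascents k (π b.1)) b.2 := by
  rw [Nat.nth_eq_getD_sort (p := (· ∈ ascents k (π b.1))) (ascents k (π b.1)).finite_toSet,
    tabOfPaths]
  congr 2
  ext x
  simp

theorem IsPath.eq_add_count {ii : ℕ → ℕ} {k : ℕ} {p : ℕ → ℤ} (hp : IsPath ii k p) {t : ℕ}
    (ht : t ≤ k) : p t = p 0 + Nat.count (· ∈ ascents k p) (t + 1) := by
  induction t with
  | zero => simp [Nat.count_succ, mem_ascents]
  | succ t ih =>
    rw [Nat.count_succ]
    have := ih (by omega)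
    have h := hp (t + 1) (by omega) ht
    simp only [Nat.add_sub_cancel] at h
    split_ifs with hm
    · rw [mem_ascents] at hm
      have := hm.2
      simp only [Nat.add_sub_cancel] at this
      push_cast
      omega
    · have : p (t + 1) ≠ p t + 1 := fun h' => hm (mem_ascents.2 ⟨by omega, by simpa using h'⟩)
      push_cast
      omega

theorem IsPath.card_ascents {ii : ℕ → ℕ} {k : ℕ} {p : ℕ → ℤ} (hp : IsPath ii k p) :
    p k = p 0 + (ascents k p).card := by
  rw [hp.eq_add_count le_rfl, Nat.count_eq_card_filter_range]
  congr 3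
  ext x
  simp only [Finset.mem_filter, Finset.mem_range, mem_ascents]
  omega

theorem card_toFinset_mem (S : Finset ℕ) (hf : (Set.ofPred (· ∈ S)).Finite) :
    hf.toFinset.card = S.card := by
  congr 1
  ext x
  simp

section PathFam

variable {l : ℕ → ℕ} {i k : ℕ} {ii : ℕ → ℕ} {π : ℕ → ℕ → ℤ}

theorem card_ascents_of_mem_pathFam (hl : IsPartition l) (hπ : π ∈ PathFam l i k ii) (n : ℕ) :
    (ascents k (π n)).card = l n := by
  obtain ⟨h1, h2, -⟩ := hπ
  by_cases hn : n ≤ Nmax l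
  · obtain ⟨hp, h0, hk, -⟩ := h1 n hn
    have := hp.card_ascents
    omega
  · have : l n = 0 := by
      by_contra h
      exact hn (hl.le_Nmax_of_pos (Nat.pos_of_ne_zero h))
    rw [h2 n (by omega), this]
    simp [ascents]

theorem lt_of_nonCrossing (hπ : π ∈ PathFam l i k ii) {n : ℕ} (hn : n + 1 ≤ Nmax l) {t : ℕ}
    (ht : t ≤ k) : π (n + 1) t < π n t := by
  obtain ⟨h1, -, h3⟩ := hπ
  obtain ⟨hp, h0, -⟩ := h1 n (by omega)
  obtain ⟨hp', h0', -⟩ := h1 (n + 1) hn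
  induction t with
  | zero => omega
  | succ t ih =>
    have := ih (by omega)
    have := hp (t + 1) (by omega) ht
    have := hp' (t + 1) (by omega) ht
    have := h3 (t + 1) ht n (by omega) (n + 1) hn (by omega)
    simp only [Nat.add_sub_cancel] at *
    omega

theorem count_ascents_anti (hπ : π ∈ PathFam l i k ii) {m n : ℕ} (hmn : m ≤ n)
    (hn : n ≤ Nmax l) {t : ℕ} (ht : t ≤ k) :
    Nat.count (· ∈ ascents k (π n)) (t + 1) ≤ Nat.count (· ∈ ascents k (π m)) (t + 1) := by
  induction n, hmn using Nat.le_induction with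
  | base => rfl
  | succ n hmn ih =>
    refine le_trans ?_ (ih (by omega))
    have := lt_of_nonCrossing hπ hn ht
    obtain ⟨hp, h0, -⟩ := hπ.1 n (by omega)
    obtain ⟨hp', h0', -⟩ := hπ.1 (n + 1) hn
    have := hp.eq_add_count ht
    have := hp'.eq_add_count ht
    omega

theorem tabOfPaths_lt_card (hl : IsPartition l) (hπ : π ∈ PathFam l i k ii) {b : ℕ × ℕ}
    (hb : b ∈ boxes l) (hf : (Set.ofPred (· ∈ ascents k (π b.1))).Finite) :
    b.2 < hf.toFinset.card := by
  rw [card_toFinset_mem, card_ascents_of_mem_pathFam hl hπ]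
  exact hb

theorem tabOfPaths_mem_ascents (hl : IsPartition l) (hπ : π ∈ PathFam l i k ii) {b : ℕ × ℕ}
    (hb : b ∈ boxes l) : tabOfPaths k π b ∈ ascents k (π b.1) := by
  rw [tabOfPaths_eq_nth]
  exact Nat.nth_mem b.2 (tabOfPaths_lt_card hl hπ hb)

theorem count_tabOfPaths (hl : IsPartition l) (hπ : π ∈ PathFam l i k ii) {b : ℕ × ℕ}
    (hb : b ∈ boxes l) :
    Nat.count (· ∈ ascents k (π b.1)) (tabOfPaths k π b) = b.2 := by
  rw [tabOfPaths_eq_nth]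
  exact Nat.count_nth (tabOfPaths_lt_card hl hπ hb)

theorem exists_tabOfPaths_eq (hl : IsPartition l) (hπ : π ∈ PathFam l i k ii) {n t : ℕ}
    (ht : t ∈ ascents k (π n)) : ∃ a, (n, a) ∈ boxes l ∧ tabOfPaths k π (n, a) = t := by
  obtain ⟨a, ha, hat⟩ := Nat.exists_lt_card_finite_nth_eq (p := (· ∈ ascents k (π n)))
    (ascents k (π n)).finite_toSet ht
  rw [card_toFinset_mem, card_ascents_of_mem_pathFam hl hπ] at ha
  exact ⟨a, ha, by rw [tabOfPaths_eq_nth, hat]⟩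

theorem tabOfPaths_mem_chess (hl : IsPartition l) (hii : Alternating k ii)
    (hπ : π ∈ PathFam l i k ii) :
    tabOfPaths k π ∈ ChessAllSet l ((i + ii 1 + 1) % 2) k := by
  refine ⟨fun b hb => (mem_ascents.1 (tabOfPaths_mem_ascents hl hπ hb)).1,
    fun s t t' htt' hb => ?_, fun s s' t hss' hb => ?_, fun b hb => ?_, fun b hb => ?_⟩
  · rw [tabOfPaths_eq_nth, tabOfPaths_eq_nth]
    exact Nat.nth_lt_nth' htt' (tabOfPaths_lt_card hl hπ hb)
  · have hmem := tabOfPaths_mem_ascents hl hπ hb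
    have hcount := count_tabOfPaths hl hπ hb
    have hle := count_ascents_anti hπ hss'.le
      (hl.le_Nmax_of_pos (Nat.zero_lt_of_lt hb)) (mem_ascents.1 hmem).1.2
    rw [Nat.count_succ, if_pos hmem, hcount] at hle
    rw [tabOfPaths_eq_nth k π (s, t)]
    exact Nat.lt_succ_iff.1 (Nat.nth_lt_of_lt_count hle)
  · have hmem := tabOfPaths_mem_ascents hl hπ hb
    have hcount := count_tabOfPaths hl hπ hb
    obtain ⟨hp, h0, -⟩ := hπ.1 b.1 (hl.le_Nmax_of_pos (Nat.zero_lt_of_lt hb))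
    generalize tabOfPaths k π b = x at *
    obtain ⟨⟨hx1, hxk⟩, hx⟩ := mem_ascents.1 hmem
    have hpar := hp x hx1 hxk
    have hpc := hp.eq_add_count (t := x - 1) (by omega)
    rw [Nat.sub_add_cancel hx1, hcount] at hpc
    have := hii.mod_two hx1 hxk
    unfold boxParity
    omega
  · rw [tabOfPaths_eq_nth]
    refine Nat.nth_of_card_le (ascents k (π b.1)).finite_toSet ?_
    rw [card_toFinset_mem, card_ascents_of_mem_pathFam hl hπ]
    exact not_lt.1 hb

theorem tabOfPaths_injOn (hl : IsPartition l) :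
    Set.InjOn (tabOfPaths k) (PathFam l i k ii) := by
  have hsub : ∀ π ∈ PathFam l i k ii, ∀ ρ ∈ PathFam l i k ii, tabOfPaths k π = tabOfPaths k ρ →
      ∀ n, ascents k (π n) ⊆ ascents k (ρ n) := by
    intro π hπ ρ hρ h n t ht
    obtain ⟨a, ha, rfl⟩ := exists_tabOfPaths_eq hl hπ ht
    rw [h]
    exact tabOfPaths_mem_ascents hl hρ ha
  intro π hπ ρ hρ h
  funext n
  have hasc := (hsub π hπ ρ hρ h n).antisymm (hsub ρ hρ π hπ h.symm n)
  by_cases hn : n ≤ Nmax l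
  · obtain ⟨hp, h0, -, hc⟩ := hπ.1 n hn
    obtain ⟨hp', h0', -, hc'⟩ := hρ.1 n hn
    have heq : ∀ t ≤ k, π n t = ρ n t := fun t ht => by
      rw [hp.eq_add_count ht, hp'.eq_add_count ht, h0, h0', hasc]
    funext t
    rcases le_or_gt t k with ht | ht
    · exact heq t ht
    · rw [hc t ht, hc' t ht, heq k le_rfl]
  · rw [hπ.2.1 n (by omega), hρ.2.1 n (by omega)]

theorem ncard_ascents_eq_ncard_label (hl : IsPartition l) (hπ : π ∈ PathFam l i k ii) (t : ℕ) :
    {n | n ≤ Nmax l ∧ t ∈ ascents k (π n)}.ncard =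
      {b ∈ boxes l | tabOfPaths k π b = t}.ncard := by
  have himage : {n | n ≤ Nmax l ∧ t ∈ ascents k (π n)} =
      Prod.fst '' {b ∈ boxes l | tabOfPaths k π b = t} := by
    ext n
    constructor
    · rintro ⟨-, ht⟩
      obtain ⟨a, ha, hat⟩ := exists_tabOfPaths_eq hl hπ ht
      exact ⟨(n, a), ⟨ha, hat⟩, rfl⟩
    · rintro ⟨b, ⟨hb, rfl⟩, rfl⟩
      exact ⟨hl.le_Nmax_of_pos (Nat.zero_lt_of_lt hb), tabOfPaths_mem_ascents hl hπ hb⟩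
  rw [himage, Set.InjOn.ncard_image]
  rintro b ⟨hb, hbt⟩ c ⟨hc, hct⟩ hbc
  have h1 := count_tabOfPaths hl hπ hb
  have h2 := count_tabOfPaths hl hπ hc
  rw [hbt, hbc] at h1
  rw [hct] at h2
  exact Prod.ext hbc (h1.symm.trans h2)

end PathFam

/-- The set of labels in row `s` of the filling `T` of the diagram of `l`. -/
def rowLabels (l : ℕ → ℕ) (T : ℕ × ℕ → ℕ) (s : ℕ) : Finset ℕ :=
  (Finset.range (l s)).image fun a => T (s, a)

/-- The family of paths whose ascents are the rows of `T`. -/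
noncomputable def pathsOfTab (l : ℕ → ℕ) (i k : ℕ) (T : ℕ × ℕ → ℕ) : ℕ → ℕ → ℤ := fun n t =>
  if n ≤ Nmax l then (i : ℤ) - n + Nat.count (· ∈ rowLabels l T n) (min t k + 1) else 0

section Chess

variable {l : ℕ → ℕ} {i j k : ℕ} {ii : ℕ → ℕ} {T : ℕ × ℕ → ℕ}

theorem mem_rowLabels {s x : ℕ} : x ∈ rowLabels l T s ↔ ∃ a < l s, T (s, a) = x := by
  simp [rowLabels]

theorem injOn_row_of_mem_chess (hT : T ∈ ChessAllSet l j k) {s a b : ℕ} (ha : a < l s)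
    (hb : b < l s) (h : T (s, a) = T (s, b)) : a = b := by
  rcases lt_trichotomy a b with hab | hab | hab
  · exact absurd h (hT.2.1 s a b hab hb).ne
  · exact hab
  · exact absurd h (hT.2.1 s b a hab ha).ne'

theorem count_rowLabels (hT : T ∈ ChessAllSet l j k) (s x : ℕ) :
    Nat.count (· ∈ rowLabels l T s) x =
      ((Finset.range (l s)).filter fun a => T (s, a) < x).card := by
  rw [Nat.count_eq_card_filter_range]
  symm
  refine Finset.card_bij (fun a _ => T (s, a)) (fun a ha => ?_) (fun a ha b hb h => ?_)
    (fun x hx => ?_)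
  · simp only [Finset.mem_filter, Finset.mem_range] at ha ⊢
    exact ⟨ha.2, mem_rowLabels.2 ⟨a, ha.1, rfl⟩⟩
  · simp only [Finset.mem_filter, Finset.mem_range] at ha hb
    exact injOn_row_of_mem_chess hT ha.1 hb.1 h
  · simp only [Finset.mem_filter, Finset.mem_range] at hx
    obtain ⟨hx, hm⟩ := hx
    obtain ⟨a, ha, rfl⟩ := mem_rowLabels.1 hm
    exact ⟨a, by simp [ha, hx], rfl⟩

theorem count_rowLabels_apply (hT : T ∈ ChessAllSet l j k) {s a : ℕ} (ha : a < l s) :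
    Nat.count (· ∈ rowLabels l T s) (T (s, a)) = a := by
  rw [count_rowLabels hT]
  conv_rhs => rw [← Finset.card_range a]
  congr 1
  ext b
  simp only [Finset.mem_filter, Finset.mem_range]
  constructor
  · rintro ⟨hb, hlt⟩
    by_contra! hab
    rcases hab.lt_or_eq with hab | rfl
    · exact absurd hlt (hT.2.1 s a b hab hb).le.not_gt
    · exact lt_irrefl _ hlt
  · exact fun hb => ⟨hb.trans ha, hT.2.1 s b a hb ha⟩

theorem count_rowLabels_anti (hl : IsPartition l) (hT : T ∈ ChessAllSet l j k) {m n : ℕ}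
    (hmn : m < n) (x : ℕ) :
    Nat.count (· ∈ rowLabels l T n) x ≤ Nat.count (· ∈ rowLabels l T m) x := by
  rw [count_rowLabels hT, count_rowLabels hT]
  refine Finset.card_le_card fun a ha => ?_
  simp only [Finset.mem_filter, Finset.mem_range] at ha ⊢
  exact ⟨ha.1.trans_le (hl.1 m n hmn.le), (hT.2.2.1 m n a hmn ha.1).trans_lt ha.2⟩

theorem pathsOfTab_step {n : ℕ} (hn : n ≤ Nmax l) {t : ℕ} (h1 : 1 ≤ t) (ht : t ≤ k) :
    pathsOfTab l i k T n t =
      pathsOfTab l i k T n (t - 1) + if t ∈ rowLabels l T n then 1 else 0 := by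
  obtain ⟨t, rfl⟩ := Nat.exists_eq_add_of_le' h1
  simp only [pathsOfTab, if_pos hn, Nat.add_sub_cancel, min_eq_left ht,
    min_eq_left (Nat.le_of_succ_le ht), Nat.count_succ _ (t + 1)]
  split_ifs <;> push_cast <;> ring

theorem ascents_pathsOfTab (hT : T ∈ ChessAllSet l j k) {n : ℕ} (hn : n ≤ Nmax l) :
    ascents k (pathsOfTab l i k T n) = rowLabels l T n := by
  ext t
  rw [mem_ascents]
  constructor
  · rintro ⟨⟨h1, ht⟩, h⟩
    rw [pathsOfTab_step hn h1 ht] at h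
    by_contra hm
    simp [hm] at h
  · intro hm
    obtain ⟨a, ha, rfl⟩ := mem_rowLabels.1 hm
    obtain ⟨h1, ht⟩ := hT.1 (n, a) ha
    exact ⟨⟨h1, ht⟩, by rw [pathsOfTab_step hn h1 ht, if_pos hm]⟩

theorem pathsOfTab_mem_pathFam (hl : IsPartition l) (hii : Alternating k ii)
    (hT : T ∈ ChessAllSet l ((i + ii 1 + 1) % 2) k) : pathsOfTab l i k T ∈ PathFam l i k ii := by
  refine ⟨fun n hn => ⟨fun t h1 ht => ?_, ?_, ?_, fun t ht => ?_⟩, fun n hn => ?_,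
    fun t ht m hm n hn hmn => ?_⟩
  · rw [pathsOfTab_step hn h1 ht]
    split_ifs with h
    · refine Or.inr ⟨rfl, ?_⟩
      obtain ⟨a, ha, rfl⟩ := mem_rowLabels.1 h
      have hc := count_rowLabels_apply hT ha
      have hpar := hT.2.2.2.1 (n, a) ha
      have := hii.mod_two h1 ht
      simp only [boxParity] at hpar
      simp only [pathsOfTab, if_pos hn]
      rw [min_eq_left (by omega), Nat.sub_add_cancel h1, hc]
      omega
    · exact Or.inl (add_zero _)
  · have h0 : 0 ∉ rowLabels l T n := fun h => by
      obtain ⟨a, ha, h⟩ := mem_rowLabels.1 h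
      have := (hT.1 (n, a) ha).1
      omega
    simp [pathsOfTab, hn, Nat.count_succ, h0]
  · have hc : Nat.count (· ∈ rowLabels l T n) (k + 1) = l n := by
      rw [count_rowLabels hT, Finset.filter_true_of_mem, Finset.card_range]
      exact fun a ha => Nat.lt_succ_of_le (hT.1 (n, a) (Finset.mem_range.1 ha)).2
    simp only [pathsOfTab, if_pos hn, min_self, hc]
    ring
  · simp [pathsOfTab, ht.le]
  · funext t
    simp [pathsOfTab, hn.not_ge]
  · simp only [pathsOfTab, if_pos hm, if_pos hn]
    rcases hmn.lt_or_gt with h | h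
    · have := count_rowLabels_anti hl hT h (min t k + 1)
      omega
    · have := count_rowLabels_anti hl hT h (min t k + 1)
      omega

theorem tabOfPaths_pathsOfTab (hl : IsPartition l) (hii : Alternating k ii)
    (hT : T ∈ ChessAllSet l ((i + ii 1 + 1) % 2) k) :
    tabOfPaths k (pathsOfTab l i k T) = T := by
  have hchess := tabOfPaths_mem_chess hl hii (pathsOfTab_mem_pathFam hl hii hT)
  funext ⟨s, a⟩
  by_cases hb : (s, a) ∈ boxes l
  · rw [tabOfPaths_eq_nth, ascents_pathsOfTab hT (hl.le_Nmax_of_pos (Nat.zero_lt_of_lt hb))]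
    have h := Nat.nth_count (p := (· ∈ rowLabels l T s)) (mem_rowLabels.2 ⟨a, hb, rfl⟩)
    rwa [count_rowLabels_apply hT hb] at h
  · rw [hchess.2.2.2.2 _ hb, hT.2.2.2.2 _ hb]

end Chess

theorem paths_biject_with_chess_tableaux
    (l : ℕ → ℕ) (hl : IsPartition l) (i : ℕ) (hi : i ≤ 1)
    (k : ℕ) (ii : ℕ → ℕ) (hii : Alternating k ii) :
    Set.BijOn (tabOfPaths k) (PathFam l i k ii)
      (ChessAllSet l ((i + ii 1 + 1) % 2) k) ∧
    ∀ π ∈ PathFam l i k ii, ∀ t, 1 ≤ t → t ≤ k →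
      {n | n ≤ Nmax l ∧ t ∈ ascents k (π n)}.ncard =
        {b ∈ boxes l | tabOfPaths k π b = t}.ncard := by
  refine ⟨⟨fun π hπ => tabOfPaths_mem_chess hl hii hπ, tabOfPaths_injOn hl, fun T hT => ?_⟩,
    fun π hπ t _ _ => ncard_ascents_eq_ncard_label hl hπ t⟩
  exact ⟨_, pathsOfTab_mem_pathFam hl hii hT, tabOfPaths_pathsOfTab hl hii hT⟩
end

section
/- Let λ be a partition with exactly k nonzero parts, let i ∈ {0,1}, and let M = M(λ,i) be the shape module. Let P be the span of the first-column basis vectors {v_{s,0} : 0 ≤ s < k}. Then: (a) P is stable under α, β, α*, β*, and the linear map sending v_{s,0} to the basis vector w_{s,0} of M((1^k), i) intertwines each of α, β, α*, β* with the corresponding operator of the shape module M((1^k), i) (where 1^k is the partition with k parts all equal to 1); (b) the quotient space M/P, with the operators induced by α, β, α*, β*, is isomorphic to the shape module M(λ̄, 1−i) via the map sending v_{s,t} + P to w_{s,t−1} for t ≥ 1, where λ̄ is the partition with λ̄_s = λ_s − 1 when λ_s > 0 and λ̄_s = 0 otherwise, this isomorphism intertwining each of α, β, α*, β* with the corresponding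 operator of M(λ̄, 1−i). -/
/-- `P`: the span of the first-column basis vectors `v_{s,0}`, `s < k`. -/
noncomputable def Pmod (k : ℕ) : Submodule ℂ Amb :=
  Submodule.span ℂ (vB '' {b | b.2 = 0 ∧ b.1 < k})

/-- The column-shift map `ψ`, sending `v_{s,t}` to `v_{s,t-1}` for `t ≥ 1`
and `v_{s,0}` to `0`.  In our realisation the basis vector `w_{s,t}` of any
shape module is the ambient vector `vB (s,t)`, so `ψ` realises the map
`v_{s,t} + P ↦ w_{s,t-1}`. -/
noncomputable def shiftMap : Amb →ₗ[ℂ] Amb :=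
  Finsupp.lift _ ℂ _ fun b => if 1 ≤ b.2 then vB (b.1, b.2 - 1) else 0

/-! Statement 13: (a) `P` is Λ-stable and, identifying `v_{s,0}` with the basis
vector `w_{s,0}` of `M((1^k), i)` (in our realisation they are the same ambient
vectors, so the intertwining map is the identity and the operators of
`M((1^k), i)` are literally `opAlpha i`, … on `P`), `P` is exactly the shape
module `M((1^k), i)`; (b) `ψ` maps `M(λ,i)` onto `M(λ̄, 1−i)` with kernel
`P` inside `M(λ,i)`, intertwining `α, β, α*, β*` of `M(λ,i)` with the
corresponding operators of `M(λ̄, 1−i)`; hence the induced map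
`M/P → M(λ̄,1−i)`, `v_{s,t} + P ↦ w_{s,t-1}`, is an isomorphism of modules. -/

theorem lift_vB (f : ℕ × ℕ → Amb) (b : ℕ × ℕ) : Finsupp.lift _ ℂ _ f (vB b) = f b := by
  simp [vB]

theorem opAlpha_vB (i : ℕ) (b : ℕ × ℕ) : opAlpha i (vB b) =
    if boxParity i b.1 b.2 = 0 ∧ 1 ≤ b.2 then vB (b.1, b.2 - 1) else 0 :=
  lift_vB _ b

theorem opBeta_vB (i : ℕ) (b : ℕ × ℕ) : opBeta i (vB b) =
    if boxParity i b.1 b.2 = 1 ∧ 1 ≤ b.2 then vB (b.1, b.2 - 1) else 0 :=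
  lift_vB _ b

theorem opAlphaStar_vB (i : ℕ) (b : ℕ × ℕ) : opAlphaStar i (vB b) =
    if boxParity i b.1 b.2 = 1 ∧ 1 ≤ b.1 then vB (b.1 - 1, b.2) else 0 :=
  lift_vB _ b

theorem opBetaStar_vB (i : ℕ) (b : ℕ × ℕ) : opBetaStar i (vB b) =
    if boxParity i b.1 b.2 = 0 ∧ 1 ≤ b.1 then vB (b.1 - 1, b.2) else 0 :=
  lift_vB _ b

theorem shiftMap_vB (b : ℕ × ℕ) :
    shiftMap (vB b) = if 1 ≤ b.2 then vB (b.1, b.2 - 1) else 0 :=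
  lift_vB _ b

theorem amb_hom_ext {f g : Amb →ₗ[ℂ] Amb} (h : ∀ b, f (vB b) = g (vB b)) : f = g :=
  Finsupp.lhom_ext' fun b => LinearMap.ext_ring (h b)

theorem span_vB_eq_supported (s : Set (ℕ × ℕ)) :
    Submodule.span ℂ (vB '' s) = Finsupp.supported ℂ ℂ s :=
  (Finsupp.supported_eq_span_single ℂ s).symm

theorem mem_span_of_vB_mem {f : Amb →ₗ[ℂ] Amb} {s : Set (ℕ × ℕ)} {V : Submodule ℂ Amb}
    (h : ∀ b ∈ s, f (vB b) ∈ V) : ∀ x ∈ Submodule.span ℂ (vB '' s), f x ∈ V := by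
  have hle : Submodule.span ℂ (vB '' s) ≤ V.comap f :=
    Submodule.span_le.2 (Set.forall_mem_image.2 h)
  exact fun x hx => hle hx

theorem shiftMap_vB_zero (s : ℕ) : shiftMap (vB (s, 0)) = 0 := by
  simp [shiftMap_vB]

theorem shiftMap_vB_succ (s t : ℕ) : shiftMap (vB (s, t + 1)) = vB (s, t) := by
  simp [shiftMap_vB]

theorem shiftMap_apply (x : Amb) (s t : ℕ) : shiftMap x (s, t) = x (s, t + 1) := by
  have h : Finsupp.lapply (s, t) ∘ₗ shiftMap =
      (Finsupp.lapply (s, t + 1) : Amb →ₗ[ℂ] ℂ) := by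
    refine Finsupp.lhom_ext' fun b => LinearMap.ext_ring ?_
    change shiftMap (vB b) (s, t) = vB b (s, t + 1)
    obtain ⟨a, _ | c⟩ := b
    · rw [shiftMap_vB_zero]
      simp [vB]
    · rw [shiftMap_vB_succ]
      simp [vB, Finsupp.single_apply]
  exact LinearMap.congr_fun h x

theorem lamStable_Pmod (i k : ℕ) : LamStable i (Pmod k) := by
  refine ⟨mem_span_of_vB_mem ?_, mem_span_of_vB_mem ?_, mem_span_of_vB_mem ?_,
    mem_span_of_vB_mem ?_⟩ <;> rintro ⟨s, t⟩ ⟨rfl : t = 0, hs : s < k⟩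
  · simp [opAlpha_vB]
  · simp [opBeta_vB]
  all_goals
    simp only [opAlphaStar_vB, opBetaStar_vB]
    split_ifs
    · exact Submodule.subset_span ⟨_, ⟨rfl, (Nat.sub_le s 1).trans_lt hs⟩, rfl⟩
    · exact zero_mem _

theorem Pmod_eq_shapeModule (k : ℕ) :
    Pmod k = shapeModule (fun s => if s < k then 1 else 0) := by
  have h : {b : ℕ × ℕ | b.2 = 0 ∧ b.1 < k} = boxes (fun s => if s < k then 1 else 0) := by
    ext ⟨s, t⟩
    simp only [boxes, Set.mem_ofPred_eq]
    split_ifs <;> omega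
  rw [Pmod, shapeModule, h]

theorem map_shiftMap_shapeModule (l : ℕ → ℕ) :
    Submodule.map shiftMap (shapeModule l) = shapeModule (fun s => l s - 1) := by
  apply le_antisymm
  · refine Submodule.map_le_iff_le_comap.2 (Submodule.span_le.2 (Set.forall_mem_image.2 ?_))
    rintro ⟨s, _ | t⟩ (hb : _ < l s)
    · simp only [SetLike.mem_coe, Submodule.mem_comap, shiftMap_vB_zero, zero_mem]
    · rw [SetLike.mem_coe, Submodule.mem_comap, shiftMap_vB_succ]
      exact Submodule.subset_span ⟨_, Nat.lt_sub_of_add_lt hb, rfl⟩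
  · refine Submodule.span_le.2 ?_
    rintro _ ⟨⟨s, t⟩, hb, rfl⟩
    exact ⟨vB (s, t + 1), Submodule.subset_span ⟨_, Nat.add_lt_of_lt_sub hb, rfl⟩,
      shiftMap_vB_succ s t⟩

theorem ker_shiftMap_inf_shapeModule {l : ℕ → ℕ} {k : ℕ} (hk : ∀ s, 0 < l s ↔ s < k) :
    LinearMap.ker shiftMap ⊓ shapeModule l = Pmod k := by
  apply le_antisymm
  · rintro x ⟨hx, hxl⟩
    rw [Pmod, span_vB_eq_supported, Finsupp.mem_supported]
    rw [SetLike.mem_coe, shapeModule, span_vB_eq_supported, Finsupp.mem_supported] at hxl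
    rintro ⟨s, t⟩ hst
    have hb : t < l s := hxl hst
    refine ⟨?_, (hk s).1 (Nat.zero_lt_of_lt hb)⟩
    cases t with
    | zero => rfl
    | succ t =>
      refine absurd ?_ (Finsupp.mem_support_iff.1 hst)
      rw [← shiftMap_apply, LinearMap.mem_ker.1 hx, Finsupp.zero_apply]
  · refine Submodule.span_le.2 ?_
    rintro _ ⟨⟨s, t⟩, ⟨rfl : t = 0, hs⟩, rfl⟩
    exact ⟨shiftMap_vB_zero s, Submodule.subset_span ⟨_, (hk s).2 hs, rfl⟩⟩

theorem boxParity_succ {i : ℕ} (hi : i ≤ 1) (s t : ℕ) :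
    boxParity i s (t + 1) = boxParity (1 - i) s t := by
  unfold boxParity
  omega

theorem shiftMap_comp_opAlpha {i : ℕ} (hi : i ≤ 1) :
    shiftMap ∘ₗ opAlpha i = opAlpha (1 - i) ∘ₗ shiftMap := by
  refine amb_hom_ext ?_
  rintro ⟨s, _ | _ | t⟩ <;>
    simp [opAlpha_vB, apply_ite shiftMap, shiftMap_vB_zero, shiftMap_vB_succ,
      boxParity_succ hi]

theorem shiftMap_comp_opBeta {i : ℕ} (hi : i ≤ 1) :
    shiftMap ∘ₗ opBeta i = opBeta (1 - i) ∘ₗ shiftMap := by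
  refine amb_hom_ext ?_
  rintro ⟨s, _ | _ | t⟩ <;>
    simp [opBeta_vB, apply_ite shiftMap, shiftMap_vB_zero, shiftMap_vB_succ,
      boxParity_succ hi]

theorem shiftMap_comp_opAlphaStar {i : ℕ} (hi : i ≤ 1) :
    shiftMap ∘ₗ opAlphaStar i = opAlphaStar (1 - i) ∘ₗ shiftMap := by
  refine amb_hom_ext ?_
  rintro ⟨s, _ | t⟩ <;>
    simp [opAlphaStar_vB, apply_ite shiftMap, shiftMap_vB_zero, shiftMap_vB_succ,
      boxParity_succ hi]

theorem shiftMap_comp_opBetaStar {i : ℕ} (hi : i ≤ 1) :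
    shiftMap ∘ₗ opBetaStar i = opBetaStar (1 - i) ∘ₗ shiftMap := by
  refine amb_hom_ext ?_
  rintro ⟨s, _ | t⟩ <;>
    simp [opBetaStar_vB, apply_ite shiftMap, shiftMap_vB_zero, shiftMap_vB_succ,
      boxParity_succ hi]

theorem first_column_and_quotient_of_shape_module
    (l : ℕ → ℕ) (hl : IsPartition l) (k : ℕ) (hk : ∀ s, 0 < l s ↔ s < k)
    (i : ℕ) (hi : i ≤ 1) :
    -- (a)
    (LamStable i (Pmod k) ∧
      Pmod k = shapeModule (fun s => if s < k then 1 else 0)) ∧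
    -- (b)
    (Submodule.map shiftMap (shapeModule l) = shapeModule (fun s => l s - 1) ∧
      LinearMap.ker shiftMap ⊓ shapeModule l = Pmod k ∧
      (∀ x ∈ shapeModule l,
        shiftMap (opAlpha i x) = opAlpha (1 - i) (shiftMap x) ∧
        shiftMap (opBeta i x) = opBeta (1 - i) (shiftMap x) ∧
        shiftMap (opAlphaStar i x) = opAlphaStar (1 - i) (shiftMap x) ∧
        shiftMap (opBetaStar i x) = opBetaStar (1 - i) (shiftMap x))) := by
  exact ⟨⟨lamStable_Pmod i k, Pmod_eq_shapeModule k⟩, map_shiftMap_shapeModule l,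
    ker_shiftMap_inf_shapeModule hk, fun x _ =>
      ⟨LinearMap.congr_fun (shiftMap_comp_opAlpha hi) x,
        LinearMap.congr_fun (shiftMap_comp_opBeta hi) x,
        LinearMap.congr_fun (shiftMap_comp_opAlphaStar hi) x,
        LinearMap.congr_fun (shiftMap_comp_opBetaStar hi) x⟩⟩
end
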